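/- Let q be a square prime power and let s ≥ 2 be an integer with s ≤ √q − 1. Then R_q(s) ≥ 1/s − 1/(√q − 1). (This is the instance of the bound R_q(s) ≥ 1/s − 1/A(q) for square q, where Ihara's constant satisfies A(q) = √q − 1.) -/

import Mathlib

open Filter

/-- The set of descendants of a set `A ⊆ S^n` of words: all words agreeing in each
coordinate with some word of `A`. -/
def descSet {S : Type*} {n : ℕ} (A : Set (Fin n → S)) : Set (Fin n → S) :=
  {x | ∀ i, ∃ a ∈ A, x i = a i}

/-- A `q`-ary `s`-frameproof code of length `n`: for every `A ⊆ C` with `|A| ≤ s`,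
`desc(A) ∩ C = A`. -/
def IsFrameproof {S : Type*} {n : ℕ} (s : ℕ) (C : Set (Fin n → S)) : Prop :=
  ∀ A ⊆ C, A.ncard ≤ s → descSet A ∩ C = A

/-- `M_q(n,s)`: the maximal size of a `q`-ary `s`-frameproof code of length `n`. -/
noncomputable def Mfp (q n s : ℕ) : ℕ :=
  sSup {M | ∃ C : Set (Fin n → Fin q), IsFrameproof s C ∧ C.ncard = M}

/-- `R_q(s) = limsup_{n→∞} log_q M_q(n,s) / n`. -/
noncomputable def Rfp (q s : ℕ) : ℝ :=
  limsup (fun n => Real.logb q (Mfp q n s) / (n : ℝ)) atTop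

open Polynomial IntermediateField Pointwise

/-- The additive polynomial `y ^ ℓ + y`. -/
def addPoly {R : Type*} [CommRing R] (ℓ : ℕ) (y : R) : R := y ^ ℓ + y

section Valuation

variable {L Γ : Type*} [Field L] [LinearOrderedCommGroupWithZero Γ] (v : Valuation L Γ)
  {ℓ : ℕ} {y z : L}

lemma addPoly_eq_mul {R : Type*} [CommRing R] {ℓ : ℕ} (hℓ : 2 ≤ ℓ) (y : R) :
    addPoly ℓ y = y * (1 + y ^ (ℓ - 1)) := by
  obtain ⟨m, rfl⟩ : ∃ m, ℓ = m + 1 := ⟨ℓ - 1, by omega⟩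
  simp only [addPoly, Nat.add_sub_cancel]; ring

lemma val_one_add_pow_of_lt {m : ℕ} (hm : m ≠ 0) (hy : v y < 1) : v (1 + y ^ m) = 1 := by
  apply Valuation.map_one_add_of_lt
  rw [map_pow]; exact pow_lt_one₀ zero_le hy hm

lemma val_one_add_pow_of_gt {m : ℕ} (hm : m ≠ 0) (hy : 1 < v y) :
    v (1 + y ^ m) = v y ^ m := by
  rw [← map_pow]
  apply Valuation.map_add_eq_of_lt_right
  rw [map_one, map_pow]; exact one_lt_pow₀ hy hm

lemma val_one_add_pow_le {m : ℕ} (hy : v y ≤ 1) : v (1 + y ^ m) ≤ 1 := by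
  refine (v.map_add _ _).trans (max_le (by simp) ?_)
  rw [map_pow]; exact pow_le_one₀ zero_le hy

lemma val_addPoly_of_lt (hℓ : 2 ≤ ℓ) (hy : v y < 1) : v (addPoly ℓ y) = v y := by
  rw [addPoly_eq_mul hℓ, map_mul, val_one_add_pow_of_lt v (by omega) hy, mul_one]

lemma val_addPoly_of_gt (hℓ : 2 ≤ ℓ) (hy : 1 < v y) : v (addPoly ℓ y) = v y ^ ℓ := by
  rw [addPoly_eq_mul hℓ, map_mul, val_one_add_pow_of_gt v (by omega) hy, ← pow_succ']
  congr 1; omega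

lemma val_le_one_of_addPoly (hℓ : 2 ≤ ℓ) (hy : v (addPoly ℓ y) ≤ 1) : v y ≤ 1 := by
  by_contra! h
  rw [val_addPoly_of_gt v hℓ h] at hy
  exact absurd hy (not_le.2 (one_lt_pow₀ h (by omega)))

end Valuation

/-- A recursive tower `x 0, x 1, …` with
`(x (i + 1) ^ ℓ + x (i + 1)) * (1 + x i ^ (ℓ - 1)) = x i ^ ℓ` over a field with `ℓ ^ 2` elements
(the second tower of Garcia and Stichtenoth). -/
structure GSTower (k : Type*) {L : Type*} [Field k] [Field L] [Algebra k L] (ℓ : ℕ)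
    (x : ℕ → L) : Prop where
  two_le : 2 ≤ ℓ
  add_pow : ∀ a b : L, (a + b) ^ ℓ = a ^ ℓ + b ^ ℓ
  card : Nat.card k = ℓ ^ 2
  transcendental : Transcendental k (x 0)
  step : ∀ i, addPoly ℓ (x (i + 1)) * (1 + x i ^ (ℓ - 1)) = x i ^ ℓ

/-- The valuation subring contains the constant field. -/
def IsOver (k : Type*) {L : Type*} [Field k] [Field L] [Algebra k L] (A : ValuationSubring L) :
    Prop := ∀ c : k, algebraMap k L c ∈ A

lemma exists_notMem_of_not_isIntegral (k : Type*) {L : Type*} [Field k] [Field L] [Algebra k L]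
    {y : L} (hy : ¬ IsIntegral k y) : ∃ A : ValuationSubring L, IsOver k A ∧ y ∉ A := by
  by_contra! h
  apply hy
  have hmem : y ∈ (⨅ V : {V : ValuationSubring L //
      Set.range (algebraMap k L) ⊆ V.toSubring}, V.1.toSubring) := by
    rw [Subring.mem_iInf]
    rintro ⟨V, hV⟩
    exact h V fun c => hV ⟨c, rfl⟩
  rw [iInf_valuationSubring_superset] at hmem
  have hcl : Subring.closure (Set.range (algebraMap k L)) = (algebraMap k L).range := by
    rw [← RingHom.coe_range, Subring.closure_eq]
  rw [hcl] at hmem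
  have hitg : IsIntegral (algebraMap k L).range y := hmem
  obtain ⟨P, hP, hPy⟩ := hitg
  obtain ⟨Q, hQ, -, hQm⟩ := Polynomial.lifts_and_degree_eq_and_monic
    (f := (algebraMap k L).rangeRestrict) ((Polynomial.mem_lifts _).2
      (Polynomial.map_surjective _ (algebraMap k L).rangeRestrict_surjective P)) hP
  refine ⟨Q, hQm, ?_⟩
  rw [← hQ, Polynomial.eval₂_map] at hPy
  exact hPy

lemma IsOver.val_const {k L : Type*} [Field k] [Field L] [Algebra k L] {A : ValuationSubring L}
    (hA : IsOver k A) {c : k} (hc : c ≠ 0) : A.valuation (algebraMap k L c) = 1 := by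
  refine le_antisymm ((A.valuation_le_one_iff _).2 (hA c)) ?_
  have h := (A.valuation_le_one_iff _).2 (hA c⁻¹)
  rw [map_inv₀, map_inv₀] at h
  have h0 : A.valuation (algebraMap k L c) ≠ 0 := by simpa using hc
  exact (inv_le_one₀ (zero_lt_iff.2 h0)).1 h

lemma IsOver.val_const_le {k L : Type*} [Field k] [Field L] [Algebra k L] {A : ValuationSubring L}
    (hA : IsOver k A) (c : k) : A.valuation (algebraMap k L c) ≤ 1 :=
  (A.valuation_le_one_iff _).2 (hA c)

namespace GSTower

variable {k L : Type*} [Field k] [Field L] [Algebra k L] {ℓ : ℕ} {x : ℕ → L}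
  {Γ : Type*} [LinearOrderedCommGroupWithZero Γ] (v : Valuation L Γ)

lemma val_succ_of_gt (h : GSTower k ℓ x) {i : ℕ} (hi : 1 < v (x i)) :
    1 < v (x (i + 1)) ∧ v (x (i + 1)) ^ ℓ = v (x i) := by
  have hℓ := h.two_le
  have h1 := congrArg v (h.step i)
  rw [map_mul, val_one_add_pow_of_gt v (by omega) hi, map_pow] at h1
  have h2 : v (x i) ^ ℓ = v (x i) * v (x i) ^ (ℓ - 1) := by
    rw [← pow_succ']; congr 1; omega
  rw [h2] at h1
  have h3 := mul_right_cancel₀ (pow_ne_zero _ (zero_lt_one.trans hi).ne') h1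
  have h4 : 1 < v (x (i + 1)) := by
    by_contra! h5
    have : v (addPoly ℓ (x (i + 1))) ≤ 1 := by
      rw [addPoly_eq_mul hℓ, map_mul]
      exact mul_le_one₀ h5 zero_le (val_one_add_pow_le v h5)
    rw [h3] at this
    exact absurd hi (not_lt.2 this)
  exact ⟨h4, by rw [← val_addPoly_of_gt v hℓ h4, h3]⟩

lemma val_gt (h : GSTower k ℓ x) (h0 : 1 < v (x 0)) (i : ℕ) : 1 < v (x i) := by
  induction i with
  | zero => exact h0
  | succ i ih => exact (h.val_succ_of_gt v ih).1

lemma exists_infinite (h : GSTower k ℓ x) :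
    ∃ A : ValuationSubring L, IsOver k A ∧ x 0 ∉ A :=
  exists_notMem_of_not_isIntegral k fun hi => h.transcendental hi.isAlgebraic

lemma ne_zero (h : GSTower k ℓ x) (i : ℕ) : x i ≠ 0 := by
  obtain ⟨A, -, hA⟩ := h.exists_infinite
  have := h.val_gt A.valuation (not_le.1 (mt (A.valuation_le_one_iff _).1 hA)) i
  intro h0
  rw [h0, map_zero] at this
  exact absurd this (by simp)

lemma one_add_ne_zero (h : GSTower k ℓ x) (i : ℕ) : 1 + x i ^ (ℓ - 1) ≠ 0 := by
  intro h0
  have := h.step i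
  rw [h0, mul_zero] at this
  exact pow_ne_zero _ (h.ne_zero i) this.symm

lemma addPoly_ne_zero (h : GSTower k ℓ x) (i : ℕ) : addPoly ℓ (x i) ≠ 0 := by
  rw [addPoly_eq_mul h.two_le]; exact mul_ne_zero (h.ne_zero i) (h.one_add_ne_zero i)

lemma val_pos (h : GSTower k ℓ x) (i : ℕ) : 0 < v (x i) :=
  zero_lt_iff.2 ((v.ne_zero_iff).2 (h.ne_zero i))

lemma addPoly_succ (h : GSTower k ℓ x) (i : ℕ) :
    addPoly ℓ (x (i + 1)) = x i ^ ℓ / (1 + x i ^ (ℓ - 1)) := by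
  rw [eq_div_iff (h.one_add_ne_zero i), h.step]

lemma val_of_addPoly_lt (h : GSTower k ℓ x) {i : ℕ} (hi : v (addPoly ℓ (x (i + 1))) < 1) :
    v (x i) < 1 ∧ v (addPoly ℓ (x (i + 1))) = v (x i) ^ ℓ := by
  have hℓ := h.two_le
  have h1 : v (x i) < 1 := by
    have h2 : v (x i) ≤ 1 := by
      by_contra! h2
      obtain ⟨h3, h4⟩ := h.val_succ_of_gt v h2
      rw [val_addPoly_of_gt v hℓ h3, h4] at hi
      exact absurd h2 hi.not_gt
    have h3 := congrArg v (h.step i)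
    rw [map_mul, map_pow] at h3
    by_contra! h4
    have h5 : v (x i) = 1 := le_antisymm h2 h4
    rw [h5, one_pow] at h3
    have h6 : v (addPoly ℓ (x (i + 1))) * v (1 + x i ^ (ℓ - 1)) < 1 :=
      mul_lt_one_of_lt_of_le hi (val_one_add_pow_le v h2)
    exact absurd h3 h6.ne
  refine ⟨h1, ?_⟩
  rw [h.addPoly_succ, map_div₀, val_one_add_pow_of_lt v (by omega) h1, div_one, map_pow]

lemma val_of_lt_succ (h : GSTower k ℓ x) {i : ℕ} (hi : v (x (i + 1)) < 1) :
    v (x i) < 1 ∧ v (x (i + 1)) = v (x i) ^ ℓ := by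
  have h1 := val_addPoly_of_lt v h.two_le hi
  have := h.val_of_addPoly_lt v (h1 ▸ hi)
  rwa [h1] at this

section

variable {Γ : Type*} [LinearOrderedCommGroupWithZero Γ] (v : Valuation L Γ)

lemma neg_pow' (h : GSTower k ℓ x) (a : L) : (-a) ^ ℓ = -a ^ ℓ := by
  have := h.add_pow (-a) a
  rw [neg_add_cancel, zero_pow (by have := h.two_le; omega)] at this
  exact eq_neg_of_add_eq_zero_left this.symm

lemma sub_pow' (h : GSTower k ℓ x) (a b : L) : (a - b) ^ ℓ = a ^ ℓ - b ^ ℓ := by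
  rw [sub_eq_add_neg, h.add_pow, h.neg_pow', ← sub_eq_add_neg]

lemma addPoly_sub (h : GSTower k ℓ x) (a b : L) :
    addPoly ℓ (a - b) = addPoly ℓ a - addPoly ℓ b := by
  simp only [addPoly, h.sub_pow']; ring

lemma finite (h : GSTower k ℓ x) : Finite k :=
  Nat.finite_of_card_ne_zero (by rw [h.card]; have := h.two_le; positivity)

lemma val_eq_one_of_pole (h : GSTower k ℓ x) {a : ℕ} (ha : v (1 + x a ^ (ℓ - 1)) < 1) :
    v (x a) = 1 := by
  have hℓ := h.two_le
  rcases lt_trichotomy (v (x a)) 1 with h1 | h1 | h1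
  · rw [val_one_add_pow_of_lt v (by omega) h1] at ha; exact absurd ha (lt_irrefl _)
  · exact h1
  · rw [val_one_add_pow_of_gt v (by omega) h1] at ha
    exact absurd ha (not_lt.2 (one_lt_pow₀ h1 (by omega)).le)

lemma val_addPoly_of_pole (h : GSTower k ℓ x) {a : ℕ} (ha : v (1 + x a ^ (ℓ - 1)) < 1) :
    v (addPoly ℓ (x a)) = v (1 + x a ^ (ℓ - 1)) := by
  rw [addPoly_eq_mul h.two_le, map_mul, h.val_eq_one_of_pole v ha, one_mul]

lemma val_succ_of_pole (h : GSTower k ℓ x) {a : ℕ} (ha : v (1 + x a ^ (ℓ - 1)) < 1) :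
    1 < v (x (a + 1)) ∧ v (x (a + 1)) ^ ℓ = (v (1 + x a ^ (ℓ - 1)))⁻¹ := by
  have h1 : v (addPoly ℓ (x (a + 1))) = (v (1 + x a ^ (ℓ - 1)))⁻¹ := by
    rw [h.addPoly_succ, map_div₀, map_pow, h.val_eq_one_of_pole v ha, one_pow, one_div]
  have h2 : 1 < v (x (a + 1)) := by
    by_contra! h5
    have : v (addPoly ℓ (x (a + 1))) ≤ 1 := by
      rw [addPoly_eq_mul h.two_le, map_mul]
      exact mul_le_one₀ h5 zero_le (val_one_add_pow_le v h5)
    rw [h1] at this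
    exact absurd ((one_lt_inv₀ (zero_lt_iff.2 (v.ne_zero_iff.2 (h.one_add_ne_zero a)))).2 ha)
      (not_lt.2 this)
  exact ⟨h2, by rw [← val_addPoly_of_gt v h.two_le h2, h1]⟩

lemma val_add_of_pole (h : GSTower k ℓ x) {a : ℕ} (ha : v (1 + x a ^ (ℓ - 1)) < 1) (d : ℕ) :
    1 < v (x (a + (d + 1))) ∧
      v (x (a + (d + 1))) ^ ℓ ^ (d + 1) = (v (1 + x a ^ (ℓ - 1)))⁻¹ := by
  induction d with
  | zero => simpa using h.val_succ_of_pole v ha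
  | succ d ih =>
    obtain ⟨h1, h2⟩ := h.val_succ_of_gt v ih.1
    refine ⟨h1, ?_⟩
    rw [pow_succ' ℓ (d + 1), pow_mul, ← ih.2]
    exact congrArg (· ^ ℓ ^ (d + 1)) h2

lemma val_sub_of_pole (h : GSTower k ℓ x) {b d : ℕ}
    (ha : v (1 + x (b + (d + 1)) ^ (ℓ - 1)) < 1) :
    v (x b) < 1 ∧ v (x b) ^ ℓ ^ (d + 1) = v (1 + x (b + (d + 1)) ^ (ℓ - 1)) := by
  induction d generalizing b with
  | zero =>
    have h1 := h.val_addPoly_of_pole v ha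
    have h2 := h.val_of_addPoly_lt (i := b) v (h1 ▸ ha)
    refine ⟨h2.1, ?_⟩
    rw [zero_add, pow_one, ← h2.2, h1]
  | succ d ih =>
    have e : b + (d + 1 + 1) = (b + 1) + (d + 1) := by omega
    rw [e] at ha ⊢
    obtain ⟨h1, h2⟩ := ih ha
    obtain ⟨h3, h4⟩ := h.val_of_lt_succ v h1
    refine ⟨h3, ?_⟩
    rw [pow_succ' ℓ (d + 1), pow_mul, ← h4, h2]

lemma val_generic (h : GSTower k ℓ x) {i : ℕ}
    (h0 : v (x i) = 1) (h1 : v (1 + x i ^ (ℓ - 1)) = 1) :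
    v (x (i + 1)) = 1 ∧ v (1 + x (i + 1) ^ (ℓ - 1)) = 1 := by
  have h2 : v (addPoly ℓ (x (i + 1))) = 1 := by
    rw [h.addPoly_succ, map_div₀, map_pow, h0, h1, one_pow, div_one]
  have h3 := val_le_one_of_addPoly v h.two_le h2.le
  rw [addPoly_eq_mul h.two_le, map_mul] at h2
  have h4 := val_one_add_pow_le v (m := ℓ - 1) h3
  constructor
  · refine le_antisymm h3 ?_
    by_contra! h5
    exact absurd h2 (mul_lt_one_of_lt_of_le h5 h4).ne
  · refine le_antisymm h4 ?_
    by_contra! h5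
    exact absurd h2 (mul_lt_one_of_nonneg_of_lt_one_right h3 zero_le h5).ne

/-- A place at which `x 0` is finite is generic, or a common zero of `x 0, …, x i`, or has a pole
starting right after a unique `x a`. -/
lemma classification (h : GSTower k ℓ x) (h0 : v (x 0) ≤ 1) (i : ℕ) :
    (∀ j, v (x j) = 1 ∧ v (1 + x j ^ (ℓ - 1)) = 1) ∨ (∀ j ≤ i, v (x j) < 1) ∨
      ∃ a ≤ i, v (1 + x a ^ (ℓ - 1)) < 1 := by
  induction i with
  | zero =>
    rcases h0.lt_or_eq with h1 | h1
    · right; left; intro j hj; obtain rfl : j = 0 := by omega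
      exact h1
    · rcases (val_one_add_pow_le v (m := ℓ - 1) h0).lt_or_eq with h2 | h2
      · exact Or.inr (Or.inr ⟨0, le_rfl, h2⟩)
      · left; intro j
        induction j with
        | zero => exact ⟨h1, h2⟩
        | succ j ih => exact h.val_generic v ih.1 ih.2
  | succ i ih =>
    rcases ih with h1 | h1 | ⟨a, ha, h1⟩
    · exact Or.inl h1
    · right
      have h2 := h1 i le_rfl
      have h3 : v (addPoly ℓ (x (i + 1))) < 1 := by
        rw [h.addPoly_succ, map_div₀, val_one_add_pow_of_lt v (by have := h.two_le; omega) h2,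
          div_one, map_pow]
        exact pow_lt_one₀ zero_le h2 (by have := h.two_le; omega)
      have h4 := val_le_one_of_addPoly v h.two_le h3.le
      rcases h4.lt_or_eq with h5 | h5
      · left; intro j hj
        rcases Nat.le_succ_iff.1 hj with h6 | rfl
        · exact h1 j h6
        · exact h5
      · right
        refine ⟨i + 1, le_rfl, ?_⟩
        rwa [addPoly_eq_mul h.two_le, map_mul, h5, one_mul] at h3
    · exact Or.inr (Or.inr ⟨a, by omega, h1⟩)

end

lemma pow_card_sub (h : GSTower k ℓ x) (y : L) :
    addPoly ℓ y ^ ℓ - addPoly ℓ y = ∏ᶠ c : k, (y - algebraMap k L c) := by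
  have := h.finite
  have := Fintype.ofFinite k
  have hp : (∏ c : k, (X - C c)) = (X ^ Fintype.card k - X : k[X]) := by
    have h1 : 1 < Fintype.card k := Fintype.one_lt_card
    have hm : (X ^ Fintype.card k - X : k[X]).Monic := by
      apply monic_X_pow_sub
      rw [degree_X]; exact_mod_cast h1
    have h2 := prod_multiset_X_sub_C_of_monic_of_roots_card_eq hm (by
      rw [FiniteField.roots_X_pow_card_sub_X, FiniteField.X_pow_card_sub_X_natDegree_eq k h1]
      rfl)
    rwa [FiniteField.roots_X_pow_card_sub_X] at h2
  have h1 := congrArg (aeval y) hp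
  rw [finprod_eq_prod_of_fintype]
  simp only [map_prod, map_sub, aeval_X, aeval_C, map_pow] at h1
  rw [h1, ← Nat.card_eq_fintype_card, h.card, addPoly, h.add_pow]
  ring

variable {A : ValuationSubring L}

lemma exists_root_of_pole (h : GSTower k ℓ x) (hA : IsOver k A) {a : ℕ}
    (ha : A.valuation (1 + x a ^ (ℓ - 1)) < 1) :
    ∃ ω : k, ω ≠ 0 ∧ addPoly ℓ ω = 0 ∧
      A.valuation (x a - algebraMap k L ω) = A.valuation (1 + x a ^ (ℓ - 1)) := by
  have hℓ := h.two_le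
  have := h.finite
  have := Fintype.ofFinite k
  have h1 := h.val_addPoly_of_pole A.valuation ha
  obtain ⟨ω, hω⟩ : ∃ ω : k, A.valuation (x a - algebraMap k L ω) < 1 := by
    by_contra! hn
    have h2 := congrArg A.valuation (h.pow_card_sub (x a))
    rw [finprod_eq_prod_of_fintype, map_prod] at h2
    have h3 : A.valuation (addPoly ℓ (x a) ^ ℓ - addPoly ℓ (x a)) < 1 := by
      refine A.valuation.map_sub_lt ?_ (h1 ▸ ha)
      rw [map_pow]
      exact pow_lt_one₀ zero_le (h1 ▸ ha) (by omega)
    rw [h2] at h3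
    exact absurd h3 (not_lt.2
      (Finset.one_le_prod'' (f := fun c => A.valuation (x a - algebraMap k L c)) hn))
  have h4 := val_addPoly_of_lt A.valuation hℓ hω
  have h5 : algebraMap k L (addPoly ℓ ω) = addPoly ℓ (algebraMap k L ω) := by simp [addPoly]
  have h6 : addPoly ℓ ω = 0 := by
    by_contra hne
    have h7 := hA.val_const hne
    rw [h5, show addPoly ℓ (algebraMap k L ω) =
      addPoly ℓ (x a) - addPoly ℓ (x a - algebraMap k L ω) by rw [h.addPoly_sub]; ring] at h7
    exact absurd h7 (A.valuation.map_sub_lt (h1 ▸ ha) (h4 ▸ hω)).ne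
  refine ⟨ω, ?_, h6, ?_⟩
  · rintro rfl
    rw [map_zero, sub_zero, h.val_eq_one_of_pole _ ha] at hω
    exact absurd hω (lt_irrefl _)
  · rw [← h4, h.addPoly_sub, ← h5, h6, map_zero, sub_zero, h1]

lemma addPoly_const_div (h : GSTower k ℓ x) {c : L} (hc : c ^ ℓ = c) (i : ℕ) :
    addPoly ℓ (c / x i) = c / addPoly ℓ (x (i + 1)) := by
  have h1 := h.ne_zero i
  have h2 := h.one_add_ne_zero i
  rw [h.addPoly_succ, addPoly, div_pow, hc]
  obtain ⟨m, rfl⟩ : ∃ m, ℓ = m + 1 := ⟨ℓ - 1, by have := h.two_le; omega⟩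
  simp only [Nat.add_sub_cancel] at h2 ⊢
  field_simp
  ring

lemma mem_of_addPoly_mem (h : GSTower k ℓ x) {y : L} (hy : addPoly ℓ y ∈ A) : y ∈ A :=
  (A.valuation_le_one_iff _).1
    (val_le_one_of_addPoly _ h.two_le ((A.valuation_le_one_iff _).2 hy))

/-- The polar part of `x (a + d)` at a place with first pole after `x a`. -/
lemma pyramid (h : GSTower k ℓ x) (hA : IsOver k A) {b d : ℕ}
    (ha : A.valuation (1 + x (b + (d + 1)) ^ (ℓ - 1)) < 1) {ω : k} (hω : ω ≠ 0)
    (hT : addPoly ℓ ω = 0)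
    (hxω : A.valuation (x (b + (d + 1)) - algebraMap k L ω) =
      A.valuation (1 + x (b + (d + 1)) ^ (ℓ - 1))) :
    x (b + (d + 1) + (d + 1)) + algebraMap k L ω ^ 2 / x b ∈ A := by
  have hℓ := h.two_le
  set w := algebraMap k L ω with hw
  have hwℓ : w ^ ℓ = - w := by
    have : addPoly ℓ w = 0 := by rw [hw, ← map_zero (algebraMap k L), ← hT]; simp [addPoly]
    exact eq_neg_of_add_eq_zero_left this
  obtain ⟨c, hcdef⟩ : ∃ c, c = -w ^ 2 := ⟨_, rfl⟩
  have hcℓ : c ^ ℓ = c := by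
    rw [hcdef, h.neg_pow', ← pow_mul, mul_comm, pow_mul, hwℓ, neg_sq]
  have hc1 : w ^ (ℓ + 1) = c := by rw [pow_succ, hwℓ, hcdef]; ring
  have hwA : w ∈ A := hA ω
  have hcA : c ∈ A := by rw [hcdef]; exact neg_mem (pow_mem hwA 2)
  have hcv : A.valuation c = 1 := by
    rw [hcdef, Valuation.map_neg, map_pow, hw, hA.val_const hω, one_pow]
  rw [show x (b + (d + 1) + (d + 1)) + w ^ 2 / x b = x (b + (d + 1) + (d + 1)) - c / x b by
    rw [hcdef]; ring]
  obtain ⟨a, hab⟩ : ∃ a, a = b + (d + 1) := ⟨_, rfl⟩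
  rw [← hab] at ha hxω ⊢
  induction d generalizing b with
  | zero =>
    apply h.mem_of_addPoly_mem
    rw [h.addPoly_sub, h.addPoly_const_div hcℓ]
    obtain rfl : a = b + 1 := hab
    have h1 : addPoly ℓ (x (b + 1 + 1)) = x (b + 1) ^ (ℓ + 1) / addPoly ℓ (x (b + 1)) := by
      rw [h.addPoly_succ, addPoly_eq_mul hℓ (x (b + 1)), pow_succ]
      have := h.ne_zero (b + 1)
      field_simp
    rw [zero_add, h1, ← sub_div]
    apply (A.valuation_le_one_iff _).1
    rw [map_div₀, h.val_addPoly_of_pole _ ha, ← hxω]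
    have hpos : 0 < A.valuation (x (b + 1) - w) := by
      rw [hxω]; exact zero_lt_iff.2 ((Valuation.ne_zero_iff _).2 (h.one_add_ne_zero _))
    rw [div_le_one₀ hpos, ← hc1]
    have hxA : x (b + 1) ∈ A := (A.valuation_le_one_iff _).1 (h.val_eq_one_of_pole _ ha).le
    obtain ⟨e, he⟩ := sub_dvd_pow_sub_pow (⟨x (b + 1), hxA⟩ : A) ⟨w, hwA⟩ (ℓ + 1)
    have he' := congrArg (Subtype.val : A → L) he
    simp at he'
    rw [he', map_mul]
    exact mul_le_of_le_one_right' ((A.valuation_le_one_iff _).2 e.2)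
  | succ d ih =>
    have hρ := ih (b := b + 1) (by omega)
    have hz : A.valuation (x (b + 1)) < 1 := by
      have : a = (b + 1) + (d + 1) := by omega
      exact (h.val_sub_of_pole A.valuation (this ▸ ha)).1
    have hz0 := h.ne_zero (b + 1)
    obtain ⟨ρ, hρdef⟩ : ∃ ρ, ρ = x (a + (d + 1)) - c / x (b + 1) := ⟨_, rfl⟩
    rw [← hρdef] at hρ
    have hD2 := h.one_add_ne_zero (b + 1)
    have hD2v := val_one_add_pow_of_lt A.valuation (m := ℓ - 1) (by omega) hz
    have hxa : 1 + x (a + (d + 1)) ^ (ℓ - 1) ≠ 0 := h.one_add_ne_zero _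
    have hT1 := h.addPoly_succ (a + (d + 1))
    have hT2 := addPoly_eq_mul hℓ (x (b + 1))
    have hcd := h.addPoly_const_div hcℓ b
    rw [hT2] at hcd
    have haa : a + (d + 1 + 1) = a + (d + 1) + 1 := by omega
    clear_value w
    generalize x (b + 1) = z at *
    obtain ⟨κ, hκ⟩ : ∃ κ, κ = c + ρ * z := ⟨_, rfl⟩
    have hx : x (a + (d + 1)) = κ / z := by rw [hκ, hρdef]; field_simp; ring
    have hzA : z ∈ A := (A.valuation_le_one_iff _).1 hz.le
    have hκA : κ ∈ A := by rw [hκ]; exact add_mem hcA (mul_mem hρ hzA)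
    have hκv : A.valuation κ = 1 := by
      rw [hκ, ← hcv]
      apply Valuation.map_add_eq_of_lt_left
      rw [hcv, map_mul]
      exact mul_lt_one_of_nonneg_of_lt_one_right ((A.valuation_le_one_iff _).2 hρ) zero_le hz
    have hD1v : A.valuation (z ^ (ℓ - 1) + κ ^ (ℓ - 1)) = 1 := by
      have : A.valuation (κ ^ (ℓ - 1)) = 1 := by rw [map_pow, hκv, one_pow]
      rw [← this]
      apply Valuation.map_add_eq_of_lt_right
      rw [this, map_pow]
      exact pow_lt_one₀ zero_le hz (by omega)
    have hD1 : z ^ (ℓ - 1) + κ ^ (ℓ - 1) ≠ 0 := by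
      rw [← Valuation.ne_zero_iff A.valuation, hD1v]; exact one_ne_zero
    apply h.mem_of_addPoly_mem
    rw [h.addPoly_sub, hcd, haa, hT1, hx]
    have key : (κ / z) ^ ℓ / (1 + (κ / z) ^ (ℓ - 1)) - c / (z * (1 + z ^ (ℓ - 1))) =
        (κ ^ (ℓ - 1) * ρ + z ^ (ℓ - 2) * (κ ^ ℓ - c)) /
          ((z ^ (ℓ - 1) + κ ^ (ℓ - 1)) * (1 + z ^ (ℓ - 1))) := by
      obtain ⟨m, rfl⟩ : ∃ m, ℓ = m + 2 := ⟨ℓ - 2, by omega⟩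
      simp only [show m + 2 - 1 = m + 1 by omega, Nat.add_sub_cancel] at hD1 hD2 ⊢
      rw [show (κ / z) ^ (m + 2) / (1 + (κ / z) ^ (m + 1)) =
        κ ^ (m + 2) / (z * (z ^ (m + 1) + κ ^ (m + 1))) by
          rw [div_pow, div_pow, one_add_div (pow_ne_zero _ hz0), div_div_eq_mul_div,
            div_mul_eq_mul_div]
          rw [div_div, div_eq_div_iff (by positivity) (by positivity)]
          ring]
      rw [div_sub_div _ _ (by positivity) (by positivity),
          div_eq_div_iff (by positivity) (by positivity)]
      linear_combination
        (κ ^ (m + 1) * z * (z ^ (m + 1) + κ ^ (m + 1)) * (1 + z ^ (m + 1))) * hκ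
    rw [key]
    apply (A.valuation_le_one_iff _).1
    rw [map_div₀, map_mul A.valuation _ (1 + z ^ (ℓ - 1)), hD1v, hD2v, mul_one, div_one]
    apply (A.valuation_le_one_iff _).2
    exact add_mem (mul_mem (pow_mem hκA _) hρ)
      (mul_mem (pow_mem hzA _) (sub_mem (pow_mem hκA _) hcA))

end GSTower

/-- The product of the denominators `1 + x j ^ (ℓ - 1)` for `j < a`. -/
def poleProd {L : Type*} [Field L] (ℓ : ℕ) (x : ℕ → L) (a : ℕ) : L :=
  ∏ j ∈ Finset.range a, (1 + x j ^ (ℓ - 1))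

/-- A global approximation to the polar part of `x (i + 1)` at the places where the first pole
comes late. -/
def polarPart {L : Type*} [Field L] (ℓ : ℕ) (x : ℕ → L) (i : ℕ) : L :=
  -∑ d ∈ Finset.range ((i + 1) / 2),
    poleProd ℓ x (i - d) ^ ℓ ^ (i + 1) * x (i - d) ^ 2 / x (i - 1 - 2 * d)

lemma poleProd_succ {L : Type*} [Field L] (ℓ : ℕ) (x : ℕ → L) (a : ℕ) :
    poleProd ℓ x (a + 1) = poleProd ℓ x a * (1 + x a ^ (ℓ - 1)) := Finset.prod_range_succ _ _

namespace GSTower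

variable {k L : Type*} [Field k] [Field L] [Algebra k L] {ℓ : ℕ} {x : ℕ → L}

lemma add_pow_pow (h : GSTower k ℓ x) (n : ℕ) (a b : L) :
    (a + b) ^ ℓ ^ n = a ^ ℓ ^ n + b ^ ℓ ^ n := by
  induction n with
  | zero => simp
  | succ n ih => rw [pow_succ, pow_mul, ih, h.add_pow, ← pow_mul, ← pow_mul]

section

variable {Γ : Type*} [LinearOrderedCommGroupWithZero Γ] (v : Valuation L Γ)

lemma poleProd_ne_zero (h : GSTower k ℓ x) (a : ℕ) : poleProd ℓ x a ≠ 0 :=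
  Finset.prod_ne_zero_iff.2 fun j _ => h.one_add_ne_zero j

lemma val_lt_of_pole (h : GSTower k ℓ x) {a j : ℕ} (ha : v (1 + x a ^ (ℓ - 1)) < 1)
    (hj : j < a) : v (x j) < 1 ∧ v (x j) ^ ℓ ^ (a - j) = v (1 + x a ^ (ℓ - 1)) := by
  obtain ⟨d, rfl⟩ : ∃ d, a = j + (d + 1) := ⟨a - j - 1, by omega⟩
  rw [Nat.add_sub_cancel_left]
  exact h.val_sub_of_pole v ha

lemma val_gt_of_pole (h : GSTower k ℓ x) {a j : ℕ} (ha : v (1 + x a ^ (ℓ - 1)) < 1)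
    (hj : a < j) : 1 < v (x j) ∧ v (x j) ^ ℓ ^ (j - a) = (v (1 + x a ^ (ℓ - 1)))⁻¹ := by
  obtain ⟨d, rfl⟩ : ∃ d, j = a + (d + 1) := ⟨j - a - 1, by omega⟩
  rw [Nat.add_sub_cancel_left]
  exact h.val_add_of_pole v ha d

lemma pole_unique (h : GSTower k ℓ x) {a b : ℕ} (ha : v (1 + x a ^ (ℓ - 1)) < 1)
    (hb : v (1 + x b ^ (ℓ - 1)) < 1) : a = b := by
  rcases lt_trichotomy a b with h1 | h1 | h1
  · exact absurd (h.val_eq_one_of_pole v hb) (h.val_gt_of_pole v ha h1).1.ne'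
  · exact h1
  · exact absurd (h.val_eq_one_of_pole v ha) (h.val_gt_of_pole v hb h1).1.ne'

lemma val_poleProd_eq_one (h : GSTower k ℓ x) {a : ℕ} (ha : ∀ j < a, v (x j) < 1) :
    v (poleProd ℓ x a) = 1 := by
  rw [poleProd, map_prod]
  exact Finset.prod_eq_one fun j hj =>
    val_one_add_pow_of_lt v (by have := h.two_le; omega) (ha j (Finset.mem_range.1 hj))

lemma val_poleProd_of_pole (h : GSTower k ℓ x) {b a : ℕ} (hb : v (1 + x b ^ (ℓ - 1)) < 1)
    (hba : b < a) : v (poleProd ℓ x a) * v (x a) ^ ℓ = 1 := by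
  induction a, hba using Nat.le_induction with
  | base =>
    rw [Nat.succ_eq_add_one, poleProd_succ, map_mul,
      h.val_poleProd_eq_one v fun j hj => (h.val_lt_of_pole v hb hj).1, one_mul,
      (h.val_succ_of_pole v hb).2, mul_inv_cancel₀]
    exact (Valuation.ne_zero_iff _).2 (h.one_add_ne_zero _)
  | succ a hba ih =>
    have h1 := (h.val_gt_of_pole v hb hba).1
    rw [poleProd_succ, map_mul, (h.val_succ_of_gt v h1).2,
      val_one_add_pow_of_gt v (by have := h.two_le; omega) h1, mul_assoc, ← pow_succ,
      Nat.sub_add_cancel (by have := h.two_le; omega), ih]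

/-- At a place where `x 0` is finite, `x a` is either finite or a pole cancelled by `poleProd`. -/
lemma val_poleProd_cases (h : GSTower k ℓ x) (h0 : v (x 0) ≤ 1) (a : ℕ) :
    (v (x a) ≤ 1 ∧ v (poleProd ℓ x a) = 1) ∨
      ∃ b < a, v (1 + x b ^ (ℓ - 1)) < 1 ∧ 1 < v (x a) ∧ v (poleProd ℓ x a) * v (x a) ^ ℓ = 1 := by
  rcases h.classification v h0 a with h1 | h1 | ⟨b, hb, h1⟩
  · left
    refine ⟨(h1 a).1.le, ?_⟩
    rw [poleProd, map_prod]
    exact Finset.prod_eq_one fun j _ => (h1 j).2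
  · exact Or.inl ⟨(h1 a le_rfl).le, h.val_poleProd_eq_one v fun j hj => h1 j hj.le⟩
  · rcases hb.lt_or_eq with h2 | rfl
    · exact Or.inr ⟨b, h2, h1, (h.val_gt_of_pole v h1 h2).1, h.val_poleProd_of_pole v h1 h2⟩
    · exact Or.inl ⟨(h.val_eq_one_of_pole v h1).le,
        h.val_poleProd_eq_one v fun j hj => (h.val_lt_of_pole v h1 hj).1⟩

lemma val_poleProd_mul_pow_le (h : GSTower k ℓ x) (h0 : v (x 0) ≤ 1) (a : ℕ) {j : ℕ}
    (hj : j ≤ ℓ) : v (poleProd ℓ x a * x a ^ j) ≤ 1 := by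
  rw [map_mul, map_pow]
  rcases h.val_poleProd_cases v h0 a with ⟨h1, h2⟩ | ⟨b, -, -, h1, h2⟩
  · rw [h2, one_mul]; exact pow_le_one₀ zero_le h1
  · rw [← h2]; gcongr
    exact h1.le

lemma val_le_of_lt (h : GSTower k ℓ x) {b d : ℕ} (hv : ∀ j ≤ b + d, v (x j) < 1) :
    v (x (b + d)) ≤ v (x b) := by
  induction d with
  | zero => exact le_rfl
  | succ d ih =>
    rw [← add_assoc, (h.val_of_lt_succ v (i := b + d) (hv (b + (d + 1)) le_rfl)).2]
    refine le_trans ?_ (ih fun j hj => hv j (by omega))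
    exact pow_le_of_le_one zero_le (hv _ (by omega)).le (by have := h.two_le; omega)

lemma val_polar_term_le (h : GSTower k ℓ x) (h0 : v (x 0) ≤ 1) {b d n : ℕ} (hn : d < n)
    (hne : ¬ v (1 + x (b + (d + 1)) ^ (ℓ - 1)) < 1) :
    v (poleProd ℓ x (b + (d + 1)) ^ ℓ ^ n * x (b + (d + 1)) ^ 2 / x b) ≤ 1 := by
  have hℓ := h.two_le
  have hzero : (∀ j ≤ b + (d + 1), v (x j) < 1) →
      v (poleProd ℓ x (b + (d + 1)) ^ ℓ ^ n * x (b + (d + 1)) ^ 2 / x b) ≤ 1 := by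
    intro hv
    rw [map_div₀, map_mul, map_pow, map_pow, h.val_poleProd_eq_one v fun j hj => hv j hj.le,
      one_pow, one_mul, div_le_one₀ (h.val_pos v b)]
    exact (pow_le_of_le_one zero_le (hv _ le_rfl).le two_ne_zero).trans (h.val_le_of_lt v hv)
  rcases h.classification v h0 (b + (d + 1)) with h1 | h1 | ⟨a, ha, h1⟩
  · have : v (poleProd ℓ x (b + (d + 1))) = 1 := by
      rw [poleProd, map_prod]; exact Finset.prod_eq_one fun j _ => (h1 j).2
    rw [map_div₀, map_mul, map_pow, map_pow, this, (h1 _).1, (h1 _).1]; simp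
  · exact hzero h1
  · rcases ha.lt_or_eq with h2 | rfl
    swap
    · exact absurd h1 hne
    set a' := b + (d + 1) with ha'
    obtain ⟨h3, h4⟩ := h.val_gt_of_pole v h1 h2
    have h5 := h.val_poleProd_of_pole v h1 h2
    have h6 : (v (x b))⁻¹ ≤ v (x a') ^ ℓ ^ (d + 1) := by
      rcases lt_or_ge b a with h7 | h7
      · obtain ⟨h8, h9⟩ := h.val_lt_of_pole v h1 h7
        have h10 : v (1 + x a ^ (ℓ - 1)) ≤ v (x b) := by
          rw [← h9]; exact pow_le_of_le_one zero_le h8.le (pow_ne_zero _ (by omega))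
        calc (v (x b))⁻¹ ≤ (v (1 + x a ^ (ℓ - 1)))⁻¹ :=
              inv_anti₀ (zero_lt_iff.2 ((Valuation.ne_zero_iff _).2 (h.one_add_ne_zero _))) h10
          _ = v (x a') ^ ℓ ^ (a' - a) := h4.symm
          _ ≤ _ := pow_le_pow_right₀ h3.le (Nat.pow_le_pow_right (by omega) (by omega))
      · have : 1 ≤ v (x b) := by
          rcases h7.lt_or_eq with h8 | rfl
          · exact (h.val_gt_of_pole v h1 h8).1.le
          · exact (h.val_eq_one_of_pole v h1).ge
        exact (inv_le_one_of_one_le₀ this).trans (one_le_pow₀ h3.le)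
    have h7 : v (poleProd ℓ x a') = (v (x a') ^ ℓ)⁻¹ := eq_inv_of_mul_eq_one_left h5
    rw [div_eq_mul_inv, map_mul, map_mul, map_pow, map_pow, map_inv₀, h7, inv_pow, ← pow_mul,
      ← pow_succ' ℓ n]
    have hpos := h.val_pos v a'
    rw [mul_assoc, inv_mul_le_one₀ (pow_pos hpos _)]
    refine (mul_le_mul_right h6 _).trans ?_
    rw [← pow_add]
    apply pow_le_pow_right₀ h3.le
    have e1 : ℓ ^ (d + 1) ≤ ℓ ^ n := Nat.pow_le_pow_right (by omega) (by omega)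
    have e2 : 2 ≤ ℓ ^ n := hℓ.trans (Nat.le_self_pow (by omega) ℓ)
    calc 2 + ℓ ^ (d + 1) ≤ ℓ ^ n * 2 := by omega
      _ ≤ ℓ ^ (n + 1) := by rw [pow_succ]; exact Nat.mul_le_mul_left _ hℓ

lemma val_poleProd_pow_sub_one (h : GSTower k ℓ x) {a n : ℕ} (hn : a ≤ n)
    (ha : v (1 + x a ^ (ℓ - 1)) < 1) :
    v (poleProd ℓ x a ^ ℓ ^ n - 1) ≤ v (1 + x a ^ (ℓ - 1)) := by
  have hℓ := h.two_le
  suffices H : ∀ m ≤ a, v (poleProd ℓ x m ^ ℓ ^ n - 1) ≤ v (1 + x a ^ (ℓ - 1)) from H a le_rfl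
  intro m hm
  induction m with
  | zero => simp [poleProd]
  | succ m ih =>
    have h1 := ih (by omega)
    obtain ⟨h2, h3⟩ := h.val_lt_of_pole v ha (j := m) (by omega)
    rw [poleProd_succ, mul_pow, h.add_pow_pow, one_pow,
      show poleProd ℓ x m ^ ℓ ^ n * (1 + (x m ^ (ℓ - 1)) ^ ℓ ^ n) - 1 =
        (poleProd ℓ x m ^ ℓ ^ n - 1) + poleProd ℓ x m ^ ℓ ^ n * (x m ^ (ℓ - 1)) ^ ℓ ^ n by ring]
    refine v.map_add_le h1 ?_
    rw [map_mul, map_pow, h.val_poleProd_eq_one v fun j hj =>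
      (h.val_lt_of_pole v ha (j := j) (by omega)).1, one_pow, one_mul, map_pow, map_pow, ← pow_mul,
      ← h3]
    apply pow_le_pow_of_le_one zero_le h2.le
    calc ℓ ^ (a - m) ≤ ℓ ^ n := Nat.pow_le_pow_right (by omega) (by omega)
      _ ≤ (ℓ - 1) * ℓ ^ n := Nat.le_mul_of_pos_left _ (by omega)

end

variable {A : ValuationSubring L}

lemma polar_term_sub_mem (h : GSTower k ℓ x) (hA : IsOver k A) {b d n : ℕ} (hn : b + (d + 1) ≤ n)
    (ha : A.valuation (1 + x (b + (d + 1)) ^ (ℓ - 1)) < 1) {ω : k}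
    (hxω : A.valuation (x (b + (d + 1)) - algebraMap k L ω) =
      A.valuation (1 + x (b + (d + 1)) ^ (ℓ - 1))) :
    poleProd ℓ x (b + (d + 1)) ^ ℓ ^ n * x (b + (d + 1)) ^ 2 / x b -
      algebraMap k L ω ^ 2 / x b ∈ A := by
  have h1 := h.val_poleProd_pow_sub_one A.valuation hn ha
  have h4 := h.val_eq_one_of_pole _ ha
  obtain ⟨h2, h3⟩ := h.val_sub_of_pole A.valuation ha
  set a := b + (d + 1) with hadef
  have h5 : A.valuation (1 + x a ^ (ℓ - 1)) ≤ A.valuation (x b) := by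
    rw [← h3]
    exact pow_le_of_le_one zero_le h2.le (pow_ne_zero _ (by have := h.two_le; omega))
  rw [← A.valuation_le_one_iff, ← sub_div, map_div₀, div_le_one₀ (h.val_pos _ _)]
  refine le_trans ?_ h5
  rw [show poleProd ℓ x a ^ ℓ ^ n * x a ^ 2 - algebraMap k L ω ^ 2 =
    (poleProd ℓ x a ^ ℓ ^ n - 1) * x a ^ 2 +
      (x a - algebraMap k L ω) * (x a + algebraMap k L ω) by ring]
  refine Valuation.map_add_le _ ?_ ?_
  · rw [map_mul, map_pow, h4, one_pow, mul_one]; exact h1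
  · rw [map_mul, hxω]
    exact mul_le_of_le_one_right' (Valuation.map_add_le _ h4.le (hA.val_const_le ω))

/-- `polarPart` either cancels the pole of `x (i + 1)`, or is itself finite and the pole, if any,
started early. -/
lemma polarPart_spec (h : GSTower k ℓ x) (hA : IsOver k A) (h0 : x 0 ∈ A) (i : ℕ) :
    x (i + 1) - polarPart ℓ x i ∈ A ∨ (polarPart ℓ x i ∈ A ∧
      (x (i + 1) ∈ A ∨ ∃ a, 2 * a ≤ i ∧ A.valuation (1 + x a ^ (ℓ - 1)) < 1)) := by
  have h0' := (A.valuation_le_one_iff _).2 h0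
  have hterm : ∀ d ∈ Finset.range ((i + 1) / 2), ¬ A.valuation (1 + x (i - d) ^ (ℓ - 1)) < 1 →
      poleProd ℓ x (i - d) ^ ℓ ^ (i + 1) * x (i - d) ^ 2 / x (i - 1 - 2 * d) ∈ A := by
    intro d hd hne
    rw [Finset.mem_range] at hd
    have e : i - d = (i - 1 - 2 * d) + (d + 1) := by omega
    rw [← A.valuation_le_one_iff]
    rw [e] at hne ⊢
    exact h.val_polar_term_le A.valuation h0' (by omega) hne
  by_cases hex : ∃ d ∈ Finset.range ((i + 1) / 2), A.valuation (1 + x (i - d) ^ (ℓ - 1)) < 1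
  · left
    obtain ⟨d, hd, ha⟩ := hex
    obtain ⟨ω, hω0, hωT, hω⟩ := h.exists_root_of_pole hA ha
    have hrest : ∑ e ∈ (Finset.range ((i + 1) / 2)).erase d,
        poleProd ℓ x (i - e) ^ ℓ ^ (i + 1) * x (i - e) ^ 2 / x (i - 1 - 2 * e) ∈ A := by
      refine sum_mem fun e he => ?_
      rw [Finset.mem_erase] at he
      refine hterm e he.2 fun hb => he.1 ?_
      have := h.pole_unique _ ha hb
      have h1 := Finset.mem_range.1 he.2
      have h2 := Finset.mem_range.1 hd
      omega
    rw [polarPart, ← Finset.add_sum_erase _ _ hd]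
    have hd' := Finset.mem_range.1 hd
    have e : i - d = (i - 1 - 2 * d) + (d + 1) := by omega
    have e' : i + 1 = (i - 1 - 2 * d) + (d + 1) + (d + 1) := by omega
    rw [e] at ha hω
    have h1 := h.pyramid hA ha hω0 hωT hω
    have h2 := h.polar_term_sub_mem hA (n := i + 1) (by omega) ha hω
    rw [← e'] at h1
    rw [← e] at h2
    have := add_mem (add_mem h1 h2) hrest
    convert this using 1
    ring
  · push Not at hex
    right
    refine ⟨neg_mem (sum_mem fun d hd => hterm d hd (not_lt.2 (hex d hd))), ?_⟩
    by_contra! hc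
    obtain ⟨hc1, hc2⟩ := hc
    rcases h.val_poleProd_cases A.valuation h0' (i + 1) with ⟨h1, -⟩ | ⟨b, hb, h1, -⟩
    · exact hc1 ((A.valuation_le_one_iff _).1 h1)
    · have h2 : ¬ 2 * b ≤ i := fun h2 => absurd h1 (not_lt.2 (hc2 b h2))
      have h3 := hex (i - b) (Finset.mem_range.2 (by omega))
      rw [Nat.sub_sub_self (by omega)] at h3
      exact absurd h1 (not_lt.2 h3)

end GSTower

/-- The ring generated by `x 0, …, x i` and the inverse of `addPoly ℓ (x 0)`. -/
def towerRing (k : Type*) {L : Type*} [Field k] [Field L] [Algebra k L] (ℓ : ℕ) (x : ℕ → L) :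
    ℕ → Subalgebra k L
  | 0 => Algebra.adjoin k {x 0, (addPoly ℓ (x 0))⁻¹}
  | i + 1 => (Algebra.adjoin (towerRing k ℓ x i) {x (i + 1)}).restrictScalars k

/-- `f` behaves like `c * y ^ m` at all places where `x 0` has a pole. -/
def HasLead {k L : Type*} [Field k] [Field L] [Algebra k L] (x : ℕ → L) (y f : L) (m : ℤ) (c : k) :
    Prop :=
  ∀ A : ValuationSubring L, IsOver k A → x 0 ∉ A →
    A.valuation (f - algebraMap k L c * y ^ m) < A.valuation y ^ m

section

variable {L Γ : Type*} [Field L] [LinearOrderedCommGroupWithZero Γ] (v : Valuation L Γ)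

lemma val_pow_sub_one_lt {t : L} (ht : v (t - 1) < 1) (n : ℕ) : v (t ^ n - 1) < 1 := by
  induction n with
  | zero => simp
  | succ n ih =>
    have h1 : v t = 1 := by
      rw [← v.map_one, ← sub_add_cancel t 1]
      apply Valuation.map_add_eq_of_lt_right
      rwa [v.map_one]
    rw [show t ^ (n + 1) - 1 = (t ^ n - 1) * t + (t - 1) by ring]
    refine v.map_add_lt ?_ ht
    rwa [map_mul, h1, mul_one]

lemma val_zpow_sub_one_lt {t : L} (ht : v (t - 1) < 1) (m : ℤ) : v (t ^ m - 1) < 1 := by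
  have h1 : v t = 1 := by
    rw [← v.map_one, ← sub_add_cancel t 1]
    apply Valuation.map_add_eq_of_lt_right
    rwa [v.map_one]
  have h0 : t ≠ 0 := by rw [← v.ne_zero_iff, h1]; exact one_ne_zero
  obtain ⟨n, rfl | rfl⟩ := m.eq_nat_or_neg
  · rw [zpow_natCast]; exact val_pow_sub_one_lt v ht n
  · have h2 : t ^ (-(n : ℤ)) - 1 = -((t ^ n - 1) / t ^ n) := by
      rw [zpow_neg, zpow_natCast]
      field_simp
      ring
    rw [h2, Valuation.map_neg, map_div₀, map_pow, h1, one_pow, div_one]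
    exact val_pow_sub_one_lt v ht n

end

lemma HasLead.val_eq {k L : Type*} [Field k] [Field L] [Algebra k L] {x : ℕ → L} {y f : L} {m : ℤ}
    {c : k} (hf : HasLead x y f m c) (hc : c ≠ 0) {A : ValuationSubring L} (hA : IsOver k A)
    (h0 : x 0 ∉ A) : A.valuation f = A.valuation y ^ m := by
  have h1 := hf A hA h0
  have h2 : A.valuation (algebraMap k L c * y ^ m) = A.valuation y ^ m := by
    rw [map_mul, hA.val_const hc, one_mul, map_zpow₀]
  rw [← h2, ← sub_add_cancel f (algebraMap k L c * y ^ m)]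
  rw [← h2] at h1
  exact Valuation.map_add_eq_of_lt_right _ h1

namespace GSTower

variable {k L : Type*} [Field k] [Field L] [Algebra k L] {ℓ : ℕ} {x : ℕ → L}

lemma towerRing_le_succ (_h : GSTower k ℓ x) (i : ℕ) :
    towerRing k ℓ x i ≤ towerRing k ℓ x (i + 1) := fun f hf =>
  (Algebra.adjoin (towerRing k ℓ x i) {x (i + 1)}).algebraMap_mem ⟨f, hf⟩

lemma towerRing_mono (h : GSTower k ℓ x) : Monotone (towerRing k ℓ x) :=
  monotone_nat_of_le_succ h.towerRing_le_succ

lemma mem_towerRing_self (_h : GSTower k ℓ x) (i : ℕ) : x i ∈ towerRing k ℓ x i := by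
  cases i with
  | zero => exact Algebra.subset_adjoin (Set.mem_insert _ _)
  | succ i =>
    exact Algebra.subset_adjoin (R := towerRing k ℓ x i) (Set.mem_singleton (x (i + 1)))

lemma mem_towerRing (h : GSTower k ℓ x) {j i : ℕ} (hj : j ≤ i) : x j ∈ towerRing k ℓ x i :=
  h.towerRing_mono hj (h.mem_towerRing_self j)

lemma inv_addPoly_mem (h : GSTower k ℓ x) (i : ℕ) : (addPoly ℓ (x i))⁻¹ ∈ towerRing k ℓ x i := by
  induction i with
  | zero => exact Algebra.subset_adjoin (Set.mem_insert_of_mem _ rfl)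
  | succ i ih =>
    have hx := h.mem_towerRing_self i
    have h1 := h.ne_zero i
    have h2 := h.one_add_ne_zero i
    have hinv : (x i)⁻¹ ∈ towerRing k ℓ x i := by
      have : (x i)⁻¹ = (1 + x i ^ (ℓ - 1)) * (addPoly ℓ (x i))⁻¹ := by
        rw [addPoly_eq_mul h.two_le]; field_simp
      rw [this]
      exact mul_mem (add_mem (one_mem _) (pow_mem hx _)) ih
    have : (addPoly ℓ (x (i + 1)))⁻¹ = (1 + x i ^ (ℓ - 1)) * (x i)⁻¹ ^ ℓ := by
      rw [h.addPoly_succ, inv_div, inv_pow, div_eq_mul_inv]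
    rw [this]
    exact h.towerRing_le_succ i (mul_mem (add_mem (one_mem _) (pow_mem hx _)) (pow_mem hinv _))

lemma inv_mem (h : GSTower k ℓ x) {j i : ℕ} (hj : j ≤ i) : (x j)⁻¹ ∈ towerRing k ℓ x i := by
  have h1 := h.ne_zero j
  have h2 := h.one_add_ne_zero j
  have : (x j)⁻¹ = (1 + x j ^ (ℓ - 1)) * (addPoly ℓ (x j))⁻¹ := by
    rw [addPoly_eq_mul h.two_le]; field_simp
  rw [this]
  exact h.towerRing_mono hj
    (mul_mem (add_mem (one_mem _) (pow_mem (h.mem_towerRing_self j) _)) (h.inv_addPoly_mem j))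

lemma inv_one_add_mem (h : GSTower k ℓ x) {j i : ℕ} (hj : j ≤ i) :
    (1 + x j ^ (ℓ - 1))⁻¹ ∈ towerRing k ℓ x i := by
  have h1 := h.ne_zero j
  have h2 := h.one_add_ne_zero j
  have : (1 + x j ^ (ℓ - 1))⁻¹ = x j * (addPoly ℓ (x j))⁻¹ := by
    rw [addPoly_eq_mul h.two_le]; field_simp
  rw [this]
  exact h.towerRing_mono hj (mul_mem (h.mem_towerRing_self j) (h.inv_addPoly_mem j))

lemma poleProd_mem (h : GSTower k ℓ x) {j i : ℕ} (hj : j ≤ i + 1) :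
    poleProd ℓ x j ∈ towerRing k ℓ x i :=
  prod_mem fun m hm => add_mem (one_mem _)
    (pow_mem (h.mem_towerRing (by have := Finset.mem_range.1 hm; omega)) _)

lemma addPoly_succ_mem (h : GSTower k ℓ x) (i : ℕ) :
    addPoly ℓ (x (i + 1)) ∈ towerRing k ℓ x i := by
  rw [h.addPoly_succ, div_eq_mul_inv]
  exact mul_mem (pow_mem (h.mem_towerRing_self i) _) (h.inv_one_add_mem le_rfl)

lemma polarPart_mem (h : GSTower k ℓ x) (i : ℕ) : polarPart ℓ x i ∈ towerRing k ℓ x i := by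
  refine neg_mem (sum_mem fun d _ => ?_)
  rw [div_eq_mul_inv]
  exact mul_mem (mul_mem (pow_mem (h.poleProd_mem (by omega)) _)
    (pow_mem (h.mem_towerRing (by omega)) _)) (h.inv_mem (by omega))

/-- The monic polynomial over `towerRing k ℓ x i` satisfied by `x (i + 1)`. -/
noncomputable def stepPoly (h : GSTower k ℓ x) (i : ℕ) : (towerRing k ℓ x i)[X] :=
  X ^ ℓ + (X - C ⟨addPoly ℓ (x (i + 1)), h.addPoly_succ_mem i⟩)

lemma stepPoly_monic (h : GSTower k ℓ x) (i : ℕ) : (h.stepPoly i).Monic := by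
  apply monic_X_pow_add
  rw [degree_X_sub_C]
  exact_mod_cast h.two_le

lemma natDegree_stepPoly (h : GSTower k ℓ x) (i : ℕ) : (h.stepPoly i).natDegree = ℓ := by
  rw [stepPoly, natDegree_add_eq_left_of_natDegree_lt, natDegree_X_pow]
  rw [natDegree_X_sub_C, natDegree_X_pow]
  exact h.two_le

lemma aeval_stepPoly (h : GSTower k ℓ x) (i : ℕ) : aeval (x (i + 1)) (h.stepPoly i) = 0 := by
  rw [stepPoly, map_add, map_sub, aeval_X_pow, aeval_X, aeval_C]
  change x (i + 1) ^ ℓ + (x (i + 1) - addPoly ℓ (x (i + 1))) = 0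
  rw [addPoly]; ring

lemma mem_towerRing_succ (_h : GSTower k ℓ x) {i : ℕ} {f : L} :
    f ∈ towerRing k ℓ x (i + 1) ↔ ∃ P : (towerRing k ℓ x i)[X], aeval (x (i + 1)) P = f := by
  change f ∈ Algebra.adjoin (towerRing k ℓ x i) {x (i + 1)} ↔ _
  rw [Algebra.adjoin_singleton_eq_range_aeval]
  rfl

lemma natDegree_modByMonic_lt' (h : GSTower k ℓ x) (i : ℕ) (P : (towerRing k ℓ x i)[X]) :
    (P %ₘ h.stepPoly i).natDegree < ℓ := by
  refine lt_of_lt_of_eq (natDegree_modByMonic_lt _ (h.stepPoly_monic i) ?_)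
    (h.natDegree_stepPoly i)
  intro h1
  have := h.natDegree_stepPoly i
  rw [h1, natDegree_one] at this
  have := h.two_le
  omega

lemma aeval_eq_sum (h : GSTower k ℓ x) (i : ℕ) (P : (towerRing k ℓ x i)[X]) :
    aeval (x (i + 1)) P =
      ∑ j ∈ Finset.range ℓ, ((P %ₘ h.stepPoly i).coeff j : L) * x (i + 1) ^ j := by
  rw [← aeval_modByMonic_eq_self_of_root (h.aeval_stepPoly i),
    aeval_eq_sum_range' (h.natDegree_modByMonic_lt' i P)]
  rfl

lemma exists_sum_of_mem_succ (h : GSTower k ℓ x) {i : ℕ} {f : L}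
    (hf : f ∈ towerRing k ℓ x (i + 1)) :
    ∃ c : ℕ → L, (∀ j, c j ∈ towerRing k ℓ x i) ∧
      f = ∑ j ∈ Finset.range ℓ, c j * x (i + 1) ^ j := by
  obtain ⟨P, rfl⟩ := h.mem_towerRing_succ.1 hf
  exact ⟨fun j => ((P %ₘ h.stepPoly i).coeff j : L), fun j => SetLike.coe_mem _,
    h.aeval_eq_sum i P⟩

lemma exists_pow_mul_eq_aeval (h : GSTower k ℓ x) {f : L} (hf : f ∈ towerRing k ℓ x 0) :
    ∃ (N : ℕ) (P : k[X]), f * addPoly ℓ (x 0) ^ N = aeval (x 0) P := by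
  have hT := h.addPoly_ne_zero 0
  induction hf using Algebra.adjoin_induction with
  | mem f hf =>
    rcases hf with rfl | rfl
    · exact ⟨0, X, by simp⟩
    · exact ⟨1, 1, by simp [hT]⟩
  | algebraMap c => exact ⟨0, C c, by simp⟩
  | add f g _ _ hf hg =>
    obtain ⟨N, P, hP⟩ := hf
    obtain ⟨M, Q, hQ⟩ := hg
    refine ⟨N + M, P * addPoly ℓ X ^ M + Q * addPoly ℓ X ^ N, ?_⟩
    have : aeval (x 0) (addPoly ℓ (X : k[X])) = addPoly ℓ (x 0) := by simp [addPoly]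
    rw [map_add, map_mul, map_mul, ← hP, ← hQ, map_pow, map_pow, this]; ring
  | mul f g _ _ hf hg =>
    obtain ⟨N, P, hP⟩ := hf
    obtain ⟨M, Q, hQ⟩ := hg
    exact ⟨N + M, P * Q, by rw [map_mul, ← hP, ← hQ]; ring⟩

lemma exists_lead_zero (h : GSTower k ℓ x) {f : L} (hf : f ∈ towerRing k ℓ x 0) (hf0 : f ≠ 0) :
    ∃ (m : ℤ) (c : k), c ≠ 0 ∧ HasLead x (x 0) f m c := by
  obtain ⟨N, P, hP⟩ := h.exists_pow_mul_eq_aeval hf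
  have hT := h.addPoly_ne_zero 0
  have hx0 := h.ne_zero 0
  have hP0 : P ≠ 0 := by
    rintro rfl
    rw [map_zero] at hP
    exact mul_ne_zero hf0 (pow_ne_zero _ hT) hP
  refine ⟨P.natDegree - ℓ * N, P.leadingCoeff, leadingCoeff_ne_zero.2 hP0, fun A hA h0 => ?_⟩
  have hv : 1 < A.valuation (x 0) := not_le.1 (mt (A.valuation_le_one_iff _).1 h0)
  set n := P.natDegree with hn
  set c := algebraMap k L P.leadingCoeff with hc
  have hPlow : A.valuation (aeval (x 0) P - c * x 0 ^ n) < A.valuation (x 0) ^ n := by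
    rw [aeval_eq_sum_range, Finset.sum_range_succ, Algebra.smul_def (P.coeff P.natDegree)]
    change A.valuation (∑ i ∈ Finset.range n, P.coeff i • x 0 ^ i + c * x 0 ^ n - c * x 0 ^ n) < _
    rw [add_sub_cancel_right]
    refine Valuation.map_sum_lt _ (pow_ne_zero _ (h.val_pos _ 0).ne') fun j hj => ?_
    rw [Algebra.smul_def, map_mul, map_pow]
    calc _ ≤ 1 * A.valuation (x 0) ^ j := mul_le_mul_left (hA.val_const_le _) _
      _ < _ := by rw [one_mul]; exact pow_lt_pow_right₀ hv (Finset.mem_range.1 hj)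
  have ht : A.valuation (x 0 ^ ℓ / addPoly ℓ (x 0) - 1) < 1 := by
    have : x 0 ^ ℓ / addPoly ℓ (x 0) - 1 = - (x 0 / addPoly ℓ (x 0)) := by
      rw [div_sub_one hT, ← neg_div]; congr 1; rw [addPoly]; ring
    rw [this, Valuation.map_neg, map_div₀, val_addPoly_of_gt _ h.two_le hv,
      div_lt_one₀ (pow_pos (h.val_pos _ 0) _)]
    exact lt_self_pow₀ hv h.two_le
  have ht' := val_pow_sub_one_lt _ ht N
  have hm : x 0 ^ ((n : ℤ) - ℓ * N) = x 0 ^ n / (x 0 ^ ℓ) ^ N := by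
    rw [zpow_sub₀ hx0, zpow_natCast, ← pow_mul, ← zpow_natCast (x 0) (ℓ * N)]; push_cast; rfl
  have hvT : A.valuation (addPoly ℓ (x 0) ^ N) = A.valuation ((x 0 ^ ℓ) ^ N) := by
    simp only [map_pow, val_addPoly_of_gt _ h.two_le hv]
  have hf' : f = aeval (x 0) P / addPoly ℓ (x 0) ^ N := by
    rw [← hP, mul_div_cancel_right₀ _ (pow_ne_zero _ hT)]
  have key : f - c * x 0 ^ ((n : ℤ) - ℓ * N) =
      (aeval (x 0) P - c * x 0 ^ n) / addPoly ℓ (x 0) ^ N +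
        c * (x 0 ^ n / (x 0 ^ ℓ) ^ N) * ((x 0 ^ ℓ / addPoly ℓ (x 0)) ^ N - 1) := by
    rw [hm, hf', div_pow]
    field_simp
    ring
  rw [key, ← map_zpow₀, hm]
  refine Valuation.map_add_lt _ ?_ ?_
  · rw [map_div₀, map_div₀, hvT, map_pow A.valuation (x 0)]
    gcongr
    exact zero_lt_iff.2 ((Valuation.ne_zero_iff _).2 (pow_ne_zero _ (pow_ne_zero _ hx0)))
  · rw [map_mul, map_mul]
    have hpos : 0 < A.valuation (x 0 ^ n / (x 0 ^ ℓ) ^ N) :=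
      zero_lt_iff.2 ((Valuation.ne_zero_iff _).2 (by positivity))
    calc _ ≤ 1 * A.valuation (x 0 ^ n / (x 0 ^ ℓ) ^ N) *
          A.valuation ((x 0 ^ ℓ / addPoly ℓ (x 0)) ^ N - 1) :=
          mul_le_mul_left (mul_le_mul_left (hA.val_const_le _) _) _
      _ < _ := by rw [one_mul]; exact mul_lt_of_lt_one_right hpos ht'

/-- A sum of terms `c j * x (i + 1) ^ j`, `j < ℓ`, has a leading term. -/
lemma exists_lead_sum (h : GSTower k ℓ x) {i : ℕ}
    (hi : ∀ f ∈ towerRing k ℓ x i, f ≠ 0 → ∃ (m : ℤ) (c : k), c ≠ 0 ∧ HasLead x (x i) f m c)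
    {c : ℕ → L} (hc : ∀ j, c j ∈ towerRing k ℓ x i) {j₁ : ℕ} (hj₁ : j₁ < ℓ) (hj₁c : c j₁ ≠ 0) :
    ∃ (m : ℤ) (d : k), d ≠ 0 ∧
      HasLead x (x (i + 1)) (∑ j ∈ Finset.range ℓ, c j * x (i + 1) ^ j) m d := by
  classical
  have hex : ∀ j, ∃ m : ℤ, ∃ d : k, c j ≠ 0 → d ≠ 0 ∧ HasLead x (x i) (c j) m d := by
    intro j
    by_cases hj : c j = 0
    · exact ⟨0, 0, fun h => absurd hj h⟩
    · obtain ⟨m, d, hd⟩ := hi _ (hc j) hj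
      exact ⟨m, d, fun _ => hd⟩
  choose m d hmd using hex
  obtain ⟨j₀, hj₀, hmax⟩ := Finset.exists_max_image ((Finset.range ℓ).filter fun j => c j ≠ 0)
    (fun j => ℓ * m j + j) ⟨j₁, by simp [hj₁, hj₁c]⟩
  rw [Finset.mem_filter, Finset.mem_range] at hj₀
  obtain ⟨hd0, hlead⟩ := hmd j₀ hj₀.2
  refine ⟨ℓ * m j₀ + j₀, d j₀, hd0, fun A hA h0 => ?_⟩
  have hv0 : 1 < A.valuation (x 0) := not_le.1 (mt (A.valuation_le_one_iff _).1 h0)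
  have hvi := h.val_gt _ hv0 i
  have hx := h.ne_zero i
  have hy := h.ne_zero (i + 1)
  obtain ⟨hvs, hvs'⟩ := h.val_succ_of_gt _ hvi
  have hstep := h.addPoly_succ i
  set y := x (i + 1) with hydef
  have hpow : ∀ (a : ℤ) (j : ℕ), A.valuation (x i) ^ a * A.valuation y ^ j =
      A.valuation y ^ (ℓ * a + j) := by
    intro a j
    rw [zpow_add₀ (h.val_pos _ (i + 1)).ne', zpow_mul, zpow_natCast, zpow_natCast, hvs']
  rw [← Finset.add_sum_erase _ _ (Finset.mem_range.2 hj₀.1), add_sub_right_comm]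
  refine Valuation.map_add_lt _ ?_ (Valuation.map_sum_lt _
    (zpow_ne_zero _ (h.val_pos _ (i + 1)).ne') fun j hj => ?_)
  · have ht : A.valuation (x i / y ^ ℓ - 1) < 1 := by
      have e1 : x i / y ^ ℓ - 1 =
          y ^ (1 - (ℓ : ℤ)) + (addPoly ℓ y / y ^ ℓ) * (x i / addPoly ℓ y - 1) := by
        have := h.addPoly_ne_zero (i + 1)
        rw [zpow_sub₀ hy, zpow_natCast, zpow_one, mul_sub, mul_one]
        rw [div_mul_div_comm, mul_comm (y ^ ℓ), mul_div_mul_left _ _ this, addPoly]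
        field_simp
        ring
      have e2 : x i / addPoly ℓ y - 1 = (x i ^ (ℓ - 1))⁻¹ := by
        rw [hstep]
        have := h.one_add_ne_zero i
        obtain ⟨n, rfl⟩ : ∃ n, ℓ = n + 1 := ⟨ℓ - 1, by have := h.two_le; omega⟩
        simp only [Nat.add_sub_cancel] at *
        field_simp
        ring
      rw [e1, e2]
      have hℓ := h.two_le
      refine Valuation.map_add_lt _ ?_ ?_
      · rw [map_zpow₀]
        exact zpow_lt_one_of_neg₀ hvs (by omega)
      · rw [map_mul, map_div₀, val_addPoly_of_gt _ hℓ hvs, map_pow, div_self, one_mul, map_inv₀,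
          map_pow]
        · exact inv_lt_one_of_one_lt₀ (one_lt_pow₀ hvi (by omega))
        · exact (pow_pos (h.val_pos _ _) _).ne'
    have ht' := val_zpow_sub_one_lt _ ht (m j₀)
    have e3 : c j₀ * y ^ j₀ - algebraMap k L (d j₀) * y ^ ((ℓ : ℤ) * m j₀ + j₀) =
        ((c j₀ - algebraMap k L (d j₀) * x i ^ m j₀) +
          algebraMap k L (d j₀) * (y ^ ((ℓ : ℤ) * m j₀) *
            ((x i / y ^ ℓ) ^ m j₀ - 1))) * y ^ j₀ := by
      rw [div_zpow, mul_sub, mul_one, ← zpow_natCast y ℓ, ← zpow_mul,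
        mul_div_cancel₀ _ (zpow_ne_zero _ hy),
        zpow_add₀ hy, zpow_natCast]
      ring
    rw [e3, map_mul, map_pow, ← hpow]
    refine mul_lt_mul_of_pos_right (Valuation.map_add_lt _ (hlead A hA h0) ?_)
      (pow_pos (h.val_pos _ _) _)
    rw [map_mul, hA.val_const hd0, one_mul, map_mul, map_zpow₀, zpow_mul, zpow_natCast, hvs']
    exact mul_lt_of_lt_one_right (zpow_pos (h.val_pos _ _) _) ht'
  · rw [Finset.mem_erase, Finset.mem_range] at hj
    by_cases hcj : c j = 0
    · rw [hcj, zero_mul, map_zero]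
      exact zpow_pos (h.val_pos _ _) _
    · obtain ⟨hdj, hl⟩ := hmd j hcj
      rw [map_mul, hl.val_eq hdj hA h0, map_pow, hpow]
      refine zpow_lt_zpow_right₀ hvs
        (lt_of_le_of_ne (hmax j (by simp [hj.2, hcj])) fun he => hj.1 ?_)
      have h1 : ((ℓ : ℤ) * m j + j) % ℓ = (ℓ * m j₀ + j₀) % ℓ := by rw [he]
      rw [Int.mul_add_emod_self_left, Int.mul_add_emod_self_left,
        Int.emod_eq_of_lt (by omega) (by omega),
        Int.emod_eq_of_lt (by omega) (by omega)] at h1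
      exact_mod_cast h1

lemma exists_lead (h : GSTower k ℓ x) {i : ℕ} {f : L} (hf : f ∈ towerRing k ℓ x i) (hf0 : f ≠ 0) :
    ∃ (m : ℤ) (c : k), c ≠ 0 ∧ HasLead x (x i) f m c := by
  induction i generalizing f with
  | zero => exact h.exists_lead_zero hf hf0
  | succ i ih =>
    obtain ⟨c, hc, rfl⟩ := h.exists_sum_of_mem_succ hf
    obtain ⟨j, hj, hjc⟩ : ∃ j < ℓ, c j ≠ 0 := by
      by_contra! hn
      exact hf0 (Finset.sum_eq_zero fun j hj => by rw [hn j (Finset.mem_range.1 hj), zero_mul])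
    exact h.exists_lead_sum (fun f hf hf0 => ih hf hf0) hc hj hjc

/-- The powers `x (i + 1) ^ j`, `j < ℓ`, are independent over `towerRing k ℓ x i`. -/
lemma eq_zero_of_sum_eq_zero (h : GSTower k ℓ x) {i : ℕ} {c : ℕ → L}
    (hc : ∀ j, c j ∈ towerRing k ℓ x i) (h0 : ∑ j ∈ Finset.range ℓ, c j * x (i + 1) ^ j = 0)
    {j : ℕ} (hj : j < ℓ) : c j = 0 := by
  by_contra hcj
  obtain ⟨m, d, hd, hl⟩ := h.exists_lead_sum (fun f hf hf0 => h.exists_lead hf hf0) hc hj hcj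
  obtain ⟨A, hA, hA0⟩ := h.exists_infinite
  have := hl.val_eq hd hA hA0
  rw [h0, map_zero] at this
  exact zpow_ne_zero _ (h.val_pos _ _).ne' this.symm

end GSTower

section Filtration

variable {k L : Type*} [Field k] [AddCommGroup L] [Module k L]

/-- A filtration starting at `0` all of whose steps have codimension at most one. -/
structure IsSlowFiltration (F : ℕ → Submodule k L) : Prop where
  zero : F 0 = ⊥
  mono : ∀ n, F n ≤ F (n + 1)
  step : ∀ n, ∀ f ∈ F (n + 1), ∀ g ∈ F (n + 1), g ∉ F n → ∃ c : k, f - c • g ∈ F n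

namespace IsSlowFiltration

variable {F : ℕ → Submodule k L}

lemma le_sup_span (hF : IsSlowFiltration F) (n : ℕ) :
    ∃ g, F (n + 1) ≤ F n ⊔ k ∙ g := by
  by_cases h : F (n + 1) ≤ F n
  · exact ⟨0, h.trans le_sup_left⟩
  · obtain ⟨g, hg, hg'⟩ := SetLike.not_le_iff_exists.1 h
    refine ⟨g, fun f hf => ?_⟩
    obtain ⟨c, hc⟩ := hF.step n f hf g hg hg'
    rw [← sub_add_cancel f (c • g)]
    exact Submodule.add_mem_sup hc (Submodule.smul_mem _ _ (Submodule.mem_span_singleton_self g))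

lemma finiteDimensional (hF : IsSlowFiltration F) (n : ℕ) : FiniteDimensional k (F n) := by
  induction n with
  | zero => rw [hF.zero]; infer_instance
  | succ n ih =>
    obtain ⟨g, hg⟩ := hF.le_sup_span n
    exact Submodule.finiteDimensional_of_le hg

lemma finrank_succ_le (hF : IsSlowFiltration F) (n : ℕ) :
    Module.finrank k (F (n + 1)) ≤ Module.finrank k (F n) + 1 := by
  have := hF.finiteDimensional n
  obtain ⟨g, hg⟩ := hF.le_sup_span n
  refine (Submodule.finrank_mono hg).trans
    ((Submodule.finrank_add_le_finrank_add_finrank _ _).trans ?_)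
  gcongr
  exact (finrank_span_le_card _).trans (by simp)

lemma finrank_add_le (hF : IsSlowFiltration F) (n m : ℕ) :
    Module.finrank k (F (n + m)) ≤ Module.finrank k (F n) + m := by
  induction m with
  | zero => rfl
  | succ m ih => have := hF.finrank_succ_le (n + m); rw [← add_assoc]; omega

lemma finrank_le (hF : IsSlowFiltration F) (n : ℕ) : Module.finrank k (F n) ≤ n := by
  have := hF.finrank_add_le 0 n
  rwa [hF.zero, finrank_bot, zero_add] at this

lemma gap_of_frequently (hF : IsSlowFiltration F) {g : ℕ}
    (h : ∀ n, ∃ M, n ≤ M ∧ M ≤ Module.finrank k (F M) + g) (n : ℕ) :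
    n ≤ Module.finrank k (F n) + g := by
  obtain ⟨M, hM, hg⟩ := h n
  obtain ⟨m, rfl⟩ := Nat.exists_eq_add_of_le hM
  have := hF.finrank_add_le n m
  omega

/-- A slow filtration with bounded gap is eventually strictly increasing. -/
lemma exists_forall_not_le (hF : IsSlowFiltration F) {g : ℕ}
    (h : ∀ n, n ≤ Module.finrank k (F n) + g) : ∃ M, ∀ n, M ≤ n → ¬ F (n + 1) ≤ F n := by
  obtain ⟨M, hM⟩ : ∃ M, ∀ n, M ≤ n →
      n - Module.finrank k (F n) ≤ M - Module.finrank k (F M) := by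
    by_contra! hn
    have : ∀ t : ℕ, ∃ n, t ≤ n - Module.finrank k (F n) := by
      intro t
      induction t with
      | zero => exact ⟨0, Nat.zero_le _⟩
      | succ t ih =>
        obtain ⟨n, hn'⟩ := ih
        obtain ⟨m, -, hm⟩ := hn n
        exact ⟨m, by omega⟩
    obtain ⟨n, hn'⟩ := this (g + 1)
    have := h n
    omega
  refine ⟨M, fun n hn hle => ?_⟩
  have h1 : ∀ j, M - Module.finrank k (F M) ≤ (M + j) - Module.finrank k (F (M + j)) := by
    intro j
    have := hF.finrank_add_le M j
    omega
  have h2 := hM (n + 1) (by omega)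
  have h3 := h1 (n - M)
  have h4 : Module.finrank k (F (n + 1)) ≤ Module.finrank k (F n) := by
    have := hF.finiteDimensional n
    exact Submodule.finrank_mono hle
  have h5 := hF.finrank_le n
  rw [Nat.add_sub_cancel' hn] at h3
  omega

/-- Every element of the filtration `G` is, modulo `G M`, in `J`, if the intersection with `J`
is strictly increasing after `M`. -/
lemma exists_sub_mem {G : ℕ → Submodule k L}
    (hstep : ∀ n, ∀ f ∈ G (n + 1), ∀ g ∈ G (n + 1), g ∉ G n → ∃ c : k, f - c • g ∈ G n)
    {J : Submodule k L} {M : ℕ} (hM : ∀ n, M ≤ n → ¬ J ⊓ G (n + 1) ≤ J ⊓ G n)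
    {n : ℕ} {f : L} (hf : f ∈ G (M + n)) : ∃ h ∈ J, f - h ∈ G M := by
  induction n generalizing f with
  | zero => exact ⟨0, zero_mem _, by simpa using hf⟩
  | succ n ih =>
    obtain ⟨g, hg, hg'⟩ := SetLike.not_le_iff_exists.1 (hM (M + n) (by omega))
    obtain ⟨c, hc⟩ := hstep _ f hf g hg.2 fun h => hg' ⟨hg.1, h⟩
    obtain ⟨h, hh, hfh⟩ := ih hc
    refine ⟨h + c • g, add_mem hh (J.smul_mem c hg.1), ?_⟩
    rwa [show f - (h + c • g) = f - c • g - h by abel]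

end IsSlowFiltration

lemma finrank_add_le_of_quotient {X' X H : Submodule k L} [FiniteDimensional k X]
    [FiniteDimensional k H] (Q : Submodule k L) (φ : L →ₗ[k] L) (hX : X' ≤ X) (hX' : X' ≤ Q)
    (h1 : ∀ h ∈ H, ∃ r ∈ X, r - φ h ∈ Q) (h2 : ∀ h ∈ H, φ h ∈ Q → h = 0) :
    Module.finrank k X' + Module.finrank k H ≤ Module.finrank k X := by
  let π : X →ₗ[k] L ⧸ Q := Q.mkQ ∘ₗ X.subtype
  let ψ : H →ₗ[k] L ⧸ Q := Q.mkQ ∘ₗ φ ∘ₗ H.subtype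
  have hψ : Function.Injective ψ := by
    rw [← LinearMap.ker_eq_bot, LinearMap.ker_eq_bot']
    rintro ⟨h, hh⟩ hz
    have : φ h ∈ Q := (Submodule.Quotient.mk_eq_zero Q).1 hz
    exact Subtype.ext (h2 h hh this)
  have hle : LinearMap.range ψ ≤ LinearMap.range π := by
    rintro _ ⟨⟨h, hh⟩, rfl⟩
    obtain ⟨r, hr, hrQ⟩ := h1 h hh
    exact ⟨⟨r, hr⟩, (Submodule.Quotient.eq Q).2 hrQ⟩
  have hker : X'.comap X.subtype ≤ LinearMap.ker π := fun z hz =>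
    (Submodule.Quotient.mk_eq_zero Q).2 (hX' hz)
  have e1 := π.finrank_range_add_finrank_ker
  have e2 := Submodule.finrank_mono hle
  have e3 := Submodule.finrank_mono hker
  rw [LinearMap.finrank_range_of_inj hψ] at e2
  rw [(Submodule.comapSubtypeEquivOfLe hX).finrank_eq] at e3
  omega

end Filtration

section

variable (k : Type*) {L : Type*} [Field k] [Field L] [Algebra k L]

/-- Functions whose poles are all poles of `y`. -/
def regularRing (y : L) : Subalgebra k L where
  carrier := {f | ∀ A : ValuationSubring L, IsOver k A → y ∈ A → f ∈ A}
  mul_mem' hf hg A hA hy := mul_mem (hf A hA hy) (hg A hA hy)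
  add_mem' hf hg A hA hy := add_mem (hf A hA hy) (hg A hA hy)
  algebraMap_mem' c _ hA _ := hA c

/-- Elements of size less than `z ^ n` at all poles of `y`. -/
def polarFil (y z : L) (n : ℕ) : Submodule k L where
  carrier := {f | ∀ A : ValuationSubring L, IsOver k A → y ∉ A → f = 0 ∨
    A.valuation f < A.valuation z ^ n}
  zero_mem' _ _ _ := Or.inl rfl
  add_mem' {f g} hf hg A hA hy := by
    rcases hf A hA hy with rfl | h1
    · rw [zero_add]; exact hg A hA hy
    rcases hg A hA hy with rfl | h2
    · rw [add_zero]; exact Or.inr h1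
    exact Or.inr (A.valuation.map_add_lt h1 h2)
  smul_mem' c f hf A hA hy := by
    refine (hf A hA hy).imp (fun h => by rw [h, smul_zero]) fun h => ?_
    rw [Algebra.smul_def, map_mul]
    exact (mul_le_of_le_one_left' (hA.val_const_le c)).trans_lt h

/-- The ring of regular functions at level `i` of the tower. -/
def regRing (ℓ : ℕ) (x : ℕ → L) (i : ℕ) : Subalgebra k L :=
  towerRing k ℓ x i ⊓ regularRing k (x 0)

/-- Regular functions at level `i` vanishing where `x (i + 1)` has a pole that started early. -/
def earlyIdeal (ℓ : ℕ) (x : ℕ → L) (i : ℕ) : Submodule k L where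
  carrier := {f | f ∈ regRing k ℓ x i ∧ ∀ A : ValuationSubring L, IsOver k A → x 0 ∈ A →
    ∀ a, 2 * a ≤ i → A.valuation (1 + x a ^ (ℓ - 1)) < 1 → f * addPoly ℓ (x (i + 1)) ∈ A}
  zero_mem' := ⟨zero_mem _, fun A _ _ _ _ _ => by rw [zero_mul]; exact zero_mem A⟩
  add_mem' hf hg := ⟨add_mem hf.1 hg.1, fun A hA h0 a ha hv => by
    rw [add_mul]; exact add_mem (hf.2 A hA h0 a ha hv) (hg.2 A hA h0 a ha hv)⟩
  smul_mem' c f hf := ⟨Subalgebra.smul_mem _ hf.1 c, fun A hA h0 a ha hv => by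
    rw [smul_mul_assoc, Algebra.smul_def]; exact mul_mem (hA c) (hf.2 A hA h0 a ha hv)⟩

/-- Polynomials in `y` of degree less than `t` with coefficients in `N`. -/
def polySpan {k : Type*} [Field k] [Algebra k L] (N : Submodule k L) (y : L) (t : ℕ) :
    Submodule k L where
  carrier := {f | ∃ c : ℕ → L, (∀ j, c j ∈ N) ∧ f = ∑ j ∈ Finset.range t, c j * y ^ j}
  zero_mem' := ⟨0, fun _ => zero_mem _, by simp⟩
  add_mem' := by
    rintro _ _ ⟨c, hc, rfl⟩ ⟨d, hd, rfl⟩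
    exact ⟨c + d, fun j => add_mem (hc j) (hd j), by simp [add_mul, Finset.sum_add_distrib]⟩
  smul_mem' := by
    rintro a _ ⟨c, hc, rfl⟩
    exact ⟨a • c, fun j => N.smul_mem a (hc j), by simp [Finset.smul_sum]⟩

end

section

variable {k L : Type*} [Field k] [Field L] [Algebra k L]

lemma mem_polySpan_succ {N : Submodule k L} {y : L} {t : ℕ} {f : L} :
    f ∈ polySpan N y (t + 1) ↔ ∃ g ∈ polySpan N y t, ∃ c ∈ N, f = g + c * y ^ t := by
  constructor
  · rintro ⟨c, hc, rfl⟩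
    exact ⟨_, ⟨c, hc, rfl⟩, c t, hc t, Finset.sum_range_succ _ _⟩
  · rintro ⟨_, ⟨c, hc, rfl⟩, d, hd, rfl⟩
    refine ⟨fun j => if j = t then d else c j, fun j => ?_, ?_⟩
    · beta_reduce; split_ifs
      exacts [hd, hc j]
    · beta_reduce
      rw [Finset.sum_range_succ, if_pos rfl]
      congr 1
      refine Finset.sum_congr rfl fun j hj => ?_
      rw [if_neg (Finset.mem_range.1 hj).ne]

lemma polySpan_mono {N N' : Submodule k L} (h : N ≤ N') (y : L) (t : ℕ) :
    polySpan N y t ≤ polySpan N' y t := by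
  rintro _ ⟨c, hc, rfl⟩
  exact ⟨c, fun j => h (hc j), rfl⟩

lemma polySpan_le_succ (N : Submodule k L) (y : L) (t : ℕ) :
    polySpan N y t ≤ polySpan N y (t + 1) := fun f hf =>
  mem_polySpan_succ.2 ⟨f, hf, 0, zero_mem _, by simp⟩

lemma mul_sub_pow_sub_mem_polySpan (E : Subalgebra k L) {c y u : L} (hc : c ∈ E) (hu : u ∈ E)
    (t : ℕ) : c * (y - u) ^ t - c * y ^ t ∈ polySpan (Subalgebra.toSubmodule E) y t := by
  rw [sub_eq_add_neg y u, add_pow, Finset.sum_range_succ, mul_add]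
  simp only [Nat.sub_self, pow_zero, mul_one, Nat.choose_self, Nat.cast_one, add_sub_cancel_right]
  refine ⟨fun j => c * ((-u) ^ (t - j) * (t.choose j : L)), fun j => ?_, ?_⟩
  · change c * _ ∈ E
    exact mul_mem hc (mul_mem (pow_mem (neg_mem hu) _) (natCast_mem E _))
  · rw [Finset.mul_sum]
    exact Finset.sum_congr rfl fun j _ => by ring

end

namespace GSTower

variable {k L : Type*} [Field k] [Field L] [Algebra k L] {ℓ : ℕ} {x : ℕ → L}

lemma polarFil_le_succ (h : GSTower k ℓ x) (i n : ℕ) :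
    polarFil k (x 0) (x i) n ≤ polarFil k (x 0) (x i) (n + 1) := fun f hf A hA h0 => by
  have hv := h.val_gt A.valuation (not_le.1 (mt (A.valuation_le_one_iff _).1 h0)) i
  exact (hf A hA h0).imp_right fun h1 => h1.trans (pow_lt_pow_right₀ hv (Nat.lt_succ_self n))

lemma mem_polarFil_iff (h : GSTower k ℓ x) {i n : ℕ} {f : L} (hf0 : f ≠ 0) {m : ℤ} {c : k}
    (hc : c ≠ 0) (hl : HasLead x (x i) f m c) : f ∈ polarFil k (x 0) (x i) n ↔ m < n := by
  constructor
  · intro hf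
    obtain ⟨A, hA, h0⟩ := h.exists_infinite
    have hv := h.val_gt A.valuation (not_le.1 (mt (A.valuation_le_one_iff _).1 h0)) i
    have h1 := (hf A hA h0).resolve_left hf0
    rw [hl.val_eq hc hA h0, ← zpow_natCast] at h1
    exact (zpow_lt_zpow_iff_right₀ hv).1 h1
  · intro hm A hA h0
    have hv := h.val_gt A.valuation (not_le.1 (mt (A.valuation_le_one_iff _).1 h0)) i
    right
    rw [hl.val_eq hc hA h0, ← zpow_natCast]
    exact (zpow_lt_zpow_iff_right₀ hv).2 hm

lemma polarFil_step (h : GSTower k ℓ x) {i n : ℕ} {f g : L} (hf : f ∈ towerRing k ℓ x i)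
    (hg : g ∈ towerRing k ℓ x i) (hfn : f ∈ polarFil k (x 0) (x i) (n + 1))
    (hgn : g ∈ polarFil k (x 0) (x i) (n + 1)) (hg' : g ∉ polarFil k (x 0) (x i) n) :
    ∃ c : k, f - c • g ∈ polarFil k (x 0) (x i) n := by
  by_cases hf' : f ∈ polarFil k (x 0) (x i) n
  · exact ⟨0, by simpa using hf'⟩
  have hf0 : f ≠ 0 := by rintro rfl; exact hf' (zero_mem _)
  have hg0 : g ≠ 0 := by rintro rfl; exact hg' (zero_mem _)
  obtain ⟨m, c, hc, hfl⟩ := h.exists_lead hf hf0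
  obtain ⟨m', d, hd, hgl⟩ := h.exists_lead hg hg0
  rw [h.mem_polarFil_iff hf0 hc hfl] at hfn hf'
  rw [h.mem_polarFil_iff hg0 hd hgl] at hgn hg'
  obtain rfl : m = n := by push_cast at hfn; omega
  obtain rfl : m' = n := by push_cast at hgn; omega
  refine ⟨c / d, fun A hA h0 => Or.inr ?_⟩
  have h1 := hfl A hA h0
  have h2 := hgl A hA h0
  rw [zpow_natCast, zpow_natCast] at h1 h2
  rw [show f - (c / d) • g = (f - algebraMap k L c * x i ^ n) -
      algebraMap k L (c / d) * (g - algebraMap k L d * x i ^ n) by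
    have : algebraMap k L d ≠ 0 := by simpa using hd
    rw [Algebra.smul_def, map_div₀]; field_simp; ring]
  refine Valuation.map_sub_lt _ h1 ?_
  rw [map_mul]
  exact (mul_le_of_le_one_left' (hA.val_const_le _)).trans_lt h2

lemma exists_mem_polarFil (h : GSTower k ℓ x) {i : ℕ} {f : L} (hf : f ∈ towerRing k ℓ x i)
    (M : ℕ) : ∃ n, f ∈ polarFil k (x 0) (x i) (M + n) := by
  by_cases hf0 : f = 0
  · exact ⟨0, hf0 ▸ zero_mem _⟩
  obtain ⟨m, c, hc, hfl⟩ := h.exists_lead hf hf0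
  exact ⟨(m + 1).toNat, (h.mem_polarFil_iff hf0 hc hfl).2 (by push_cast; omega)⟩

lemma eq_zero_of_regular (h : GSTower k ℓ x) {i : ℕ} {f : L} (hf : f ∈ regRing k ℓ x i)
    (hf' : f ∈ polarFil k (x 0) (x i) 0) : f = 0 := by
  by_contra hf0
  obtain ⟨B, hB, hB0⟩ := h.exists_infinite
  have hf1 := (hf' B hB hB0).resolve_left hf0
  rw [pow_zero] at hf1
  have hitg : IsIntegral k f := by
    by_contra hni
    obtain ⟨A, hA, hfA⟩ := exists_notMem_of_not_isIntegral k hni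
    by_cases h0 : x 0 ∈ A
    · exact hfA (hf.2 A hA h0)
    · have := (hf' A hA h0).resolve_left hf0
      rw [pow_zero] at this
      exact hfA ((A.valuation_le_one_iff _).1 this.le)
  have hinv : f⁻¹ ∈ B := by
    obtain ⟨P, hP, hPf⟩ := IsIntegral.inv hitg
    have : IsIntegral B f⁻¹ := ⟨P.map ((algebraMap k L).codRestrict B.toSubring hB), hP.map _, by
      rw [eval₂_map]; exact hPf⟩
    obtain ⟨b, hb⟩ := IsIntegrallyClosed.isIntegral_iff.1 this
    rw [← hb]; exact b.2
  have h2 := (B.valuation_le_one_iff _).2 hinv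
  rw [map_inv₀, inv_le_one₀ (zero_lt_iff.2 ((Valuation.ne_zero_iff _).2 hf0))] at h2
  exact absurd hf1 (not_lt.2 h2)

lemma isSlowFiltration (h : GSTower k ℓ x) (i : ℕ) {J : Submodule k L}
    (hJ : J ≤ Subalgebra.toSubmodule (regRing k ℓ x i)) :
    IsSlowFiltration fun n => J ⊓ polarFil k (x 0) (x i) n where
  zero := by
    rw [eq_bot_iff]
    exact fun f hf => h.eq_zero_of_regular (hJ hf.1) hf.2
  mono n := inf_le_inf_left J (h.polarFil_le_succ i n)
  step n f hf g hg hg' := by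
    obtain ⟨c, hc⟩ := h.polarFil_step (hJ hf.1).1 (hJ hg.1).1 hf.2 hg.2 fun h => hg' ⟨hg.1, h⟩
    exact ⟨c, sub_mem hf.1 (J.smul_mem c hg.1), hc⟩

lemma polySpan_le_polarFil (h : GSTower k ℓ x) {i M t : ℕ} (ht : t ≤ ℓ) :
    polySpan (Subalgebra.toSubmodule (towerRing k ℓ x i) ⊓ polarFil k (x 0) (x i) M)
      (x (i + 1)) t ≤ polarFil k (x 0) (x (i + 1)) (ℓ * M) := by
  rintro _ ⟨c, hc, rfl⟩
  refine sum_mem fun j hj => ?_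
  by_cases hc0 : c j = 0
  · rw [hc0, zero_mul]; exact zero_mem _
  obtain ⟨m, d, hd, hl⟩ := h.exists_lead (hc j).1 hc0
  have hm := (h.mem_polarFil_iff hc0 hd hl).1 (hc j).2
  intro A hA h0
  right
  have hv0 := not_le.1 (mt (A.valuation_le_one_iff _).1 h0)
  have hv := h.val_gt A.valuation hv0
  rw [map_mul, hl.val_eq hd hA h0, map_pow,
    ← (h.val_succ_of_gt A.valuation (hv i)).2, ← zpow_natCast, ← zpow_natCast, ← zpow_natCast,
    ← zpow_mul, ← zpow_add₀ (zero_lt_one.trans (hv (i + 1))).ne']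
  refine (zpow_lt_zpow_iff_right₀ (hv (i + 1))).2 ?_
  have hj' := Finset.mem_range.1 hj
  push_cast
  have : (ℓ : ℤ) * m + ℓ ≤ ℓ * M := by nlinarith
  omega

/-- Multiplying by powers of `x (i + 1)` minus its late polar part preserves regularity. -/
lemma mul_pow_mem_regRing (h : GSTower k ℓ x) {i t : ℕ} (ht : t < ℓ) {f : L}
    (hf : f ∈ regRing k ℓ x i) (hf' : t ≠ 0 → f ∈ earlyIdeal k ℓ x i) :
    f * (x (i + 1) - polarPart ℓ x i) ^ t ∈ regRing k ℓ x (i + 1) := by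
  refine ⟨mul_mem (h.towerRing_le_succ i hf.1) (pow_mem (sub_mem (h.mem_towerRing_self _)
    (h.towerRing_le_succ i (h.polarPart_mem i))) _), fun A hA h0 => ?_⟩
  have hfA := hf.2 A hA h0
  rcases eq_or_ne t 0 with rfl | ht0
  · simpa using hfA
  have hJ := hf' ht0
  rcases h.polarPart_spec hA h0 i with h1 | ⟨h1, h2 | ⟨a, ha, hpole⟩⟩
  · exact mul_mem hfA (pow_mem h1 _)
  · exact mul_mem hfA (pow_mem (sub_mem h2 h1) _)
  · have hgt := (h.val_gt_of_pole A.valuation hpole (j := i + 1) (by omega)).1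
    have h3 := (A.valuation_le_one_iff _).2 (hJ.2 A hA h0 a ha hpole)
    rw [← A.valuation_le_one_iff]
    refine le_trans ?_ h3
    rw [map_mul, map_mul, val_addPoly_of_gt _ h.two_le hgt, map_pow]
    refine mul_le_mul_right ?_ _
    calc A.valuation (x (i + 1) - polarPart ℓ x i) ^ t ≤ A.valuation (x (i + 1)) ^ t := by
          gcongr
          refine Valuation.map_sub_le _ le_rfl ?_
          exact ((A.valuation_le_one_iff _).2 h1).trans hgt.le
      _ ≤ _ := pow_le_pow_right₀ hgt.le ht.le

/-- A space of regular functions with bounded gap surjects onto the functions of level `i`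
modulo functions of small size at infinity. -/
lemma exists_sub_mem_polarFil (h : GSTower k ℓ x) {i : ℕ} {J : Submodule k L}
    (hJ : J ≤ Subalgebra.toSubmodule (regRing k ℓ x i)) {g : ℕ}
    (hg : ∀ n : ℕ, n ≤ Module.finrank k ↥(J ⊓ polarFil k (x 0) (x i) n) + g) :
    ∃ M₀ : ℕ, ∀ M, M₀ ≤ M → ∀ c ∈ towerRing k ℓ x i, ∃ f ∈ J,
      c - f ∈ Subalgebra.toSubmodule (towerRing k ℓ x i) ⊓ polarFil k (x 0) (x i) M := by
  obtain ⟨M₀, hM₀⟩ := (h.isSlowFiltration i hJ).exists_forall_not_le hg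
  refine ⟨M₀, fun M hM c hc => ?_⟩
  obtain ⟨n, hn⟩ := h.exists_mem_polarFil hc M
  have hJ' : ∀ n, J ⊓ (Subalgebra.toSubmodule (towerRing k ℓ x i) ⊓ polarFil k (x 0) (x i) n) =
      J ⊓ polarFil k (x 0) (x i) n := fun n => by
    rw [← inf_assoc, inf_eq_left.2 (show J ≤ Subalgebra.toSubmodule (towerRing k ℓ x i) from
      fun f hf => (hJ hf).1)]
  refine IsSlowFiltration.exists_sub_mem
    (G := fun n => Subalgebra.toSubmodule (towerRing k ℓ x i) ⊓ polarFil k (x 0) (x i) n)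
    (fun n f hf g hg hg' => ?_) (M := M) (fun n hn => ?_) (n := n) ⟨hc, hn⟩
  · obtain ⟨a, ha⟩ := h.polarFil_step hf.1 hg.1 hf.2 hg.2 fun h => hg' ⟨hg.1, h⟩
    exact ⟨a, sub_mem hf.1 (Submodule.smul_mem _ a hg.1), ha⟩
  · rw [hJ', hJ']
    exact hM₀ n (hM.trans hn)

/-- The coefficient space for `x (i + 1) ^ t` used to construct regular functions. -/
def coeffSpace (k : Type*) {L : Type*} [Field k] [Field L] [Algebra k L] (ℓ : ℕ) (x : ℕ → L)
    (i t : ℕ) : Submodule k L :=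
  if t = 0 then Subalgebra.toSubmodule (regRing k ℓ x i) else earlyIdeal k ℓ x i

lemma earlyIdeal_le (i : ℕ) :
    earlyIdeal k ℓ x i ≤ Subalgebra.toSubmodule (regRing k ℓ x i) := fun _ hf => hf.1

lemma coeffSpace_le (i t : ℕ) :
    coeffSpace k ℓ x i t ≤ Subalgebra.toSubmodule (regRing k ℓ x i) := by
  unfold coeffSpace
  split_ifs
  exacts [le_rfl, earlyIdeal_le i]

lemma mul_pow_mem_of_mem_coeffSpace (h : GSTower k ℓ x) {i t : ℕ} (ht : t < ℓ) {f : L}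
    (hf : f ∈ coeffSpace k ℓ x i t) :
    f * (x (i + 1) - polarPart ℓ x i) ^ t ∈ regRing k ℓ x (i + 1) := by
  refine h.mul_pow_mem_regRing ht (coeffSpace_le i t hf) fun ht0 => ?_
  rwa [coeffSpace, if_neg ht0] at hf

lemma exists_sub_mem_regRing (h : GSTower k ℓ x) {i M : ℕ}
    (hM : ∀ t, ∀ c ∈ towerRing k ℓ x i, ∃ f ∈ coeffSpace k ℓ x i t,
      c - f ∈ Subalgebra.toSubmodule (towerRing k ℓ x i) ⊓ polarFil k (x 0) (x i) M)
    {t : ℕ} (ht : t ≤ ℓ) {f : L}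
    (hf : f ∈ polySpan (Subalgebra.toSubmodule (towerRing k ℓ x i)) (x (i + 1)) t) :
    ∃ s ∈ polySpan (Subalgebra.toSubmodule (towerRing k ℓ x i) ⊓ polarFil k (x 0) (x i) M)
      (x (i + 1)) t, f - s ∈ regRing k ℓ x (i + 1) := by
  induction t generalizing f with
  | zero =>
    obtain ⟨c, -, rfl⟩ := hf
    exact ⟨0, zero_mem _, by simp⟩
  | succ t ih =>
    obtain ⟨f', hf', d, hd, rfl⟩ := mem_polySpan_succ.1 hf
    obtain ⟨a, ha, hda⟩ := hM t d hd
    have hr := h.mul_pow_mem_of_mem_coeffSpace (Nat.lt_of_succ_le ht) ha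
    have hdiff := mul_sub_pow_sub_mem_polySpan (y := x (i + 1)) (towerRing k ℓ x i)
      (coeffSpace_le i t ha).1 (h.polarPart_mem i) t
    obtain ⟨s, hs, hs'⟩ := ih (Nat.le_of_succ_le ht) (sub_mem hf' hdiff)
    refine ⟨_, mem_polySpan_succ.2 ⟨s, hs, _, hda, rfl⟩, ?_⟩
    convert add_mem hr hs' using 1
    ring

lemma sum_finrank_le (h : GSTower k ℓ x) {i M : ℕ}
    (hM : ∀ t, ∀ c ∈ towerRing k ℓ x i, ∃ f ∈ coeffSpace k ℓ x i t,
      c - f ∈ Subalgebra.toSubmodule (towerRing k ℓ x i) ⊓ polarFil k (x 0) (x i) M)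
    {t : ℕ} (ht : t ≤ ℓ) :
    ∑ j ∈ Finset.range t, Module.finrank k ↥(coeffSpace k ℓ x i j ⊓ polarFil k (x 0) (x i) M) ≤
      Module.finrank k ↥(Subalgebra.toSubmodule (regRing k ℓ x (i + 1)) ⊓
        polySpan (Subalgebra.toSubmodule (towerRing k ℓ x i) ⊓ polarFil k (x 0) (x i) M)
          (x (i + 1)) t) := by
  induction t with
  | zero => simp
  | succ t ih =>
    rw [Finset.sum_range_succ]
    refine (Nat.add_le_add_right (ih (Nat.le_of_succ_le ht)) _).trans ?_
    have := (h.isSlowFiltration (i + 1) le_rfl).finiteDimensional (ℓ * M)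
    have : FiniteDimensional k ↥(Subalgebra.toSubmodule (regRing k ℓ x (i + 1)) ⊓
        polySpan (Subalgebra.toSubmodule (towerRing k ℓ x i) ⊓ polarFil k (x 0) (x i) M)
          (x (i + 1)) (t + 1)) :=
      Submodule.finiteDimensional_of_le (inf_le_inf_left _ (h.polySpan_le_polarFil ht))
    have := (h.isSlowFiltration i (coeffSpace_le i t)).finiteDimensional M
    refine finrank_add_le_of_quotient
      (polySpan (Subalgebra.toSubmodule (towerRing k ℓ x i)) (x (i + 1)) t)
      (LinearMap.mulRight k (x (i + 1) ^ t)) (inf_le_inf_left _ (polySpan_le_succ _ _ _))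
      (inf_le_right.trans (polySpan_mono inf_le_left _ _)) (fun a ha => ?_) fun a ha haQ => ?_
    · have hr := h.mul_pow_mem_of_mem_coeffSpace (Nat.lt_of_succ_le ht) ha.1
      have haE := (coeffSpace_le i t ha.1).1
      have hdiff := mul_sub_pow_sub_mem_polySpan (y := x (i + 1)) (towerRing k ℓ x i)
        haE (h.polarPart_mem i) t
      obtain ⟨s, hs, hs'⟩ := h.exists_sub_mem_regRing hM (Nat.le_of_succ_le ht) hdiff
      refine ⟨s + a * x (i + 1) ^ t, ⟨?_, mem_polySpan_succ.2 ⟨s, hs, a, ⟨haE, ha.2⟩, rfl⟩⟩, ?_⟩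
      · change _ ∈ regRing k ℓ x (i + 1)
        convert sub_mem hr hs' using 1
        ring
      · rw [LinearMap.mulRight_apply, add_sub_cancel_right]
        exact polySpan_mono inf_le_left _ _ hs
    · obtain ⟨c, hc, hca⟩ := haQ
      rw [LinearMap.mulRight_apply] at hca
      have haE := (coeffSpace_le i t ha.1).1
      let d : ℕ → L := fun j => if j < t then -c j else if j = t then a else 0
      have hd : ∀ j, d j ∈ towerRing k ℓ x i := fun j => by
        simp only [d]
        split_ifs
        exacts [neg_mem (hc j), haE, zero_mem _]
      have hsum : ∑ j ∈ Finset.range ℓ, d j * x (i + 1) ^ j = 0 := by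
        rw [← Finset.sum_subset (Finset.range_subset_range.2 ht) fun j _ hj => by
          have : ¬ j < t + 1 := by simpa using hj
          simp only [d]
          rw [if_neg (by omega), if_neg (by omega), zero_mul]]
        rw [Finset.sum_range_succ, Finset.sum_congr rfl (g := fun j => -(c j * x (i + 1) ^ j))
          fun j hj => by simp only [d]; rw [if_pos (Finset.mem_range.1 hj), neg_mul],
          Finset.sum_neg_distrib, ← hca]
        simp [d]
      have := h.eq_zero_of_sum_eq_zero hd hsum (Nat.lt_of_succ_le ht)
      simpa [d] using this

lemma gap_succ (h : GSTower k ℓ x) {i g B : ℕ}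
    (hg : ∀ n : ℕ, n ≤ Module.finrank k
      ↥(Subalgebra.toSubmodule (regRing k ℓ x i) ⊓ polarFil k (x 0) (x i) n) + g)
    (hB : ∀ V : Submodule k L, FiniteDimensional k V →
      V ≤ Subalgebra.toSubmodule (regRing k ℓ x i) →
      Module.finrank k V ≤ Module.finrank k ↥(V ⊓ earlyIdeal k ℓ x i) + B) (n : ℕ) :
    n ≤ Module.finrank k ↥(Subalgebra.toSubmodule (regRing k ℓ x (i + 1)) ⊓
      polarFil k (x 0) (x (i + 1)) n) + (ℓ * g + (ℓ - 1) * B) := by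
  have hJ : ∀ n, n ≤ Module.finrank k ↥(earlyIdeal k ℓ x i ⊓ polarFil k (x 0) (x i) n) +
      (g + B) := fun n => by
    have h1 := hB _ ((h.isSlowFiltration i le_rfl).finiteDimensional n) inf_le_left
    rw [inf_right_comm, inf_eq_right.2 (earlyIdeal_le i)] at h1
    have := hg n
    omega
  obtain ⟨M₁, h₁⟩ := h.exists_sub_mem_polarFil le_rfl hg
  obtain ⟨M₂, h₂⟩ := h.exists_sub_mem_polarFil (earlyIdeal_le i) hJ
  refine (h.isSlowFiltration (i + 1) le_rfl).gap_of_frequently (fun n => ?_) n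
  have hℓ := h.two_le
  set M := max n (max M₁ M₂) with hMdef
  refine ⟨ℓ * M, by nlinarith [le_max_left n (max M₁ M₂)], ?_⟩
  have hM : ∀ t, ∀ c ∈ towerRing k ℓ x i, ∃ f ∈ coeffSpace k ℓ x i t,
      c - f ∈ Subalgebra.toSubmodule (towerRing k ℓ x i) ⊓ polarFil k (x 0) (x i) M := by
    intro t
    unfold coeffSpace
    split_ifs
    exacts [h₁ M (by omega), h₂ M (by omega)]
  have hsum := h.sum_finrank_le hM le_rfl
  have := (h.isSlowFiltration (i + 1) le_rfl).finiteDimensional (ℓ * M)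
  have hle := hsum.trans (Submodule.finrank_mono
    (inf_le_inf_left _ (h.polySpan_le_polarFil (le_refl ℓ))))
  obtain ⟨l, rfl⟩ : ∃ l, ℓ = l + 1 := ⟨ℓ - 1, by omega⟩
  rw [Finset.sum_range_succ'] at hle
  have h0 : M ≤ Module.finrank k ↥(coeffSpace k (l + 1) x i 0 ⊓ polarFil k (x 0) (x i) M) + g :=
    hg M
  have h1 : ∀ j ∈ Finset.range l, M - (g + B) ≤
      Module.finrank k ↥(coeffSpace k (l + 1) x i (j + 1) ⊓ polarFil k (x 0) (x i) M) :=
    fun j _ => by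
      rw [coeffSpace, if_neg (Nat.succ_ne_zero j)]
      have := hJ M
      omega
  have h2 := Finset.card_nsmul_le_sum _ _ _ h1
  rw [Finset.card_range, smul_eq_mul] at h2
  have h3 : l * M ≤ l * (M - (g + B)) + l * (g + B) := by
    rw [← mul_add]; exact Nat.mul_le_mul_left _ (by omega)
  rw [Nat.add_sub_cancel]
  nlinarith

lemma gap_zero (h : GSTower k ℓ x) (n : ℕ) : n ≤ Module.finrank k
    ↥(Subalgebra.toSubmodule (regRing k ℓ x 0) ⊓ polarFil k (x 0) (x 0) n) := by
  have := (h.isSlowFiltration 0 le_rfl).finiteDimensional n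
  have hli : LinearIndependent k fun j : Fin n => x 0 ^ (j : ℕ) := by
    refine LinearIndependent.comp (v := fun j : ℕ => x 0 ^ j) ?_ _ Fin.val_injective
    have := (Polynomial.basisMonomials k).linearIndependent.map' (aeval (x 0)).toLinearMap
      (LinearMap.ker_eq_bot.2 (transcendental_iff_injective.1 h.transcendental))
    rwa [show (aeval (x 0)).toLinearMap ∘ ⇑(Polynomial.basisMonomials k) = fun j : ℕ => x 0 ^ j by
      ext j; simp] at this
  have h2 := finrank_span_eq_card hli
  rw [Fintype.card_fin] at h2
  refine h2.ge.trans (Submodule.finrank_mono (Submodule.span_le.2 ?_))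
  rintro _ ⟨j, rfl⟩
  refine ⟨⟨pow_mem (h.mem_towerRing_self 0) _, fun A _ h0 => pow_mem h0 _⟩, fun A hA h0 => ?_⟩
  have hv := h.val_gt A.valuation (not_le.1 (mt (A.valuation_le_one_iff _).1 h0)) 0
  right
  rw [map_pow]
  exact pow_lt_pow_right₀ hv j.2

/-- The gap bound, given the codimension bound for `earlyIdeal`. -/
lemma gap_of_codim (h : GSTower k ℓ x)
    (hB : ∀ i, ∀ V : Submodule k L, FiniteDimensional k V →
      V ≤ Subalgebra.toSubmodule (regRing k ℓ x i) →
      Module.finrank k V ≤ Module.finrank k ↥(V ⊓ earlyIdeal k ℓ x i) + (ℓ ^ (i / 2 + 1) - 1))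
    (i n : ℕ) :
    n ≤ Module.finrank k ↥(Subalgebra.toSubmodule (regRing k ℓ x i) ⊓
      polarFil k (x 0) (x i) n) + (ℓ ^ ((i + 2) / 2) - 1) * (ℓ ^ ((i + 1) / 2) - 1) := by
  induction i generalizing n with
  | zero => simpa using h.gap_zero n
  | succ i ih =>
    have := h.gap_succ ih (hB i) n
    convert this using 2
    have e1 : (i + 1 + 2) / 2 = (i + 1) / 2 + 1 := by omega
    have e2 : (i + 1 + 1) / 2 = i / 2 + 1 := by omega
    have e3 : (i + 2) / 2 = i / 2 + 1 := by omega
    rw [e1, e2]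
    have hp := Nat.one_le_pow (i / 2 + 1) ℓ (by have := h.two_le; omega)
    have hq := Nat.one_le_pow ((i + 1) / 2) ℓ (by have := h.two_le; omega)
    obtain ⟨a, ha⟩ := Nat.exists_eq_add_of_le hp
    obtain ⟨b, hb⟩ := Nat.exists_eq_add_of_le hq
    obtain ⟨l, hl⟩ := Nat.exists_eq_add_of_le h.two_le
    rw [pow_succ ℓ ((i + 1) / 2), ha, hb]
    rw [hl, show (1 + b) * (2 + l) - 1 = b * (2 + l) + (1 + l) by
      rw [add_mul]; omega, show 2 + l - 1 = 1 + l by omega, Nat.add_sub_cancel_left,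
      Nat.add_sub_cancel_left]
    ring

end GSTower

section

variable {k L : Type*} [Field k] [Field L] [Algebra k L]

lemma exists_extension {ℓ : ℕ} (hℓ : 2 ≤ ℓ) (K M : IntermediateField k L) {S : Finset L}
    (hS : (M : Set L) ⊆ Submodule.span K (S : Set L)) {y : L} (hy : addPoly ℓ y ∈ M) :
    ∃ (M' : IntermediateField k L) (S' : Finset L), M ≤ M' ∧ y ∈ M' ∧ S'.card ≤ S.card * ℓ ∧
      (M' : Set L) ⊆ Submodule.span K (S' : Set L) := by
  classical
  let Q : M[X] := X ^ ℓ + (X - C ⟨addPoly ℓ y, hy⟩)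
  have hQ : Q.Monic := by
    apply monic_X_pow_add
    rw [degree_X_sub_C]
    exact_mod_cast hℓ
  have hQy : aeval y Q = 0 := by
    simp [Q, addPoly]
  have hQd : Q.natDegree = ℓ := by
    rw [natDegree_add_eq_left_of_natDegree_lt, natDegree_X_pow]
    rw [natDegree_X_sub_C, natDegree_X_pow]
    exact hℓ
  have hitg : IsIntegral M y := ⟨Q, hQ, hQy⟩
  refine ⟨(M⟮y⟯).restrictScalars k, S * (Finset.range ℓ).image (y ^ ·), fun f hf => ?_, ?_, ?_, ?_⟩
  · exact M⟮y⟯.algebraMap_mem ⟨f, hf⟩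
  · exact mem_adjoin_simple_self M y
  · refine Finset.card_mul_le.trans (Nat.mul_le_mul_left _ ?_)
    exact Finset.card_image_le.trans (by simp)
  · intro f hf
    have hf' : f ∈ Algebra.adjoin M {y} := by
      rw [← adjoin_simple_toSubalgebra_of_isAlgebraic hitg.isAlgebraic]; exact hf
    rw [Algebra.adjoin_singleton_eq_range_aeval] at hf'
    obtain ⟨P, rfl⟩ := hf'
    change aeval y P ∈ _
    have hd : (P %ₘ Q).natDegree < ℓ := by
      rw [← hQd]
      exact natDegree_modByMonic_lt _ hQ fun h1 => by
        rw [h1, natDegree_one] at hQd; omega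
    rw [← aeval_modByMonic_eq_self_of_root hQy, aeval_eq_sum_range' hd, Finset.coe_mul,
      ← Submodule.span_mul_span]
    refine sum_mem fun j hj => ?_
    rw [Algebra.smul_def]
    refine Submodule.mul_mem_mul (hS (SetLike.coe_mem _)) (Submodule.subset_span ?_)
    exact Finset.mem_coe.2 (Finset.mem_image_of_mem _ hj)

open scoped IntermediateField.algebraAdjoinAdjoin in
/-- Linear independence over `k(y)` can be tested by specializing polynomial relations at a
point. -/
lemma linearIndependent_adjoin {y : L} {α : k} (hy : y - algebraMap k L α ≠ 0) {σ : Type*}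
    [Fintype σ] {v : σ → L}
    (hv : ∀ P : σ → k[X], ∑ s, aeval y (P s) * v s = 0 → ∀ s, (P s).eval α = 0) :
    LinearIndependent k⟮y⟯ v := by
  have hdvd : ∀ n (P : σ → k[X]), ∑ s, aeval y (P s) * v s = 0 → ∀ s, (X - C α) ^ n ∣ P s := by
    intro n
    induction n with
    | zero => simp
    | succ n ih =>
      intro P hP s
      choose Q hQ using fun s => dvd_iff_isRoot.2 (hv P hP s)
      rw [hQ s, pow_succ']
      refine mul_dvd_mul_left _ (ih Q ?_ s)
      refine (mul_eq_zero.1 ?_).resolve_left hy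
      rw [← hP, Finset.mul_sum]
      refine Finset.sum_congr rfl fun s _ => ?_
      rw [hQ s, map_mul, map_sub, aeval_X, aeval_C, mul_assoc]
  rw [← LinearIndependent.iff_fractionRing (R := Algebra.adjoin k {y}),
    Fintype.linearIndependent_iff]
  intro g hg
  have h1 : ∀ s, ∃ Q : k[X], aeval y Q = (g s : L) := fun s =>
    (Algebra.adjoin_singleton_eq_range_aeval k y).le (g s).2
  choose Q hQ using h1
  have hrel : ∑ s, aeval y (Q s) * v s = 0 := by
    rw [← hg]
    exact Finset.sum_congr rfl fun s _ => by rw [hQ]; rfl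
  intro s
  have hQ0 : Q s = 0 := by
    by_contra hne
    have h2 := natDegree_le_of_dvd (hdvd ((Q s).natDegree + 1) Q hrel s) hne
    rw [natDegree_pow, natDegree_X_sub_C] at h2
    omega
  have h3 := hQ s
  rw [hQ0, map_zero] at h3
  exact Subtype.ext h3.symm

end

namespace GSTower

variable {k L : Type*} [Field k] [Field L] [Algebra k L] {ℓ : ℕ} {x : ℕ → L}

lemma exists_field (h : GSTower k ℓ x) {a i : ℕ} (ha : a ≤ i) :
    ∃ (M : IntermediateField k L) (S : Finset L), (∀ j ≤ i, x j ∈ M) ∧ S.card ≤ ℓ ^ i ∧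
      (M : Set L) ⊆ Submodule.span k⟮x a⟯ (S : Set L) := by
  have hdown : ∀ n ≤ a, ∃ (M : IntermediateField k L) (S : Finset L),
      (∀ j, a - n ≤ j → j ≤ a → x j ∈ M) ∧ S.card ≤ ℓ ^ n ∧
      (M : Set L) ⊆ Submodule.span k⟮x a⟯ (S : Set L) := by
    intro n hn
    induction n with
    | zero =>
      refine ⟨k⟮x a⟯, {1}, fun j hj hj' => ?_, by simp, fun f hf => ?_⟩
      · obtain rfl : j = a := by omega
        exact mem_adjoin_simple_self k _
      · have := Submodule.smul_mem _ (⟨f, hf⟩ : k⟮x a⟯)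
          (Submodule.mem_span_singleton_self (R := k⟮x a⟯) (1 : L))
        rw [Algebra.smul_def, mul_one] at this
        simpa using this
    | succ n ih =>
      obtain ⟨M, S, hM, hS, hMS⟩ := ih (by omega)
      have hstep := h.addPoly_const_div (one_pow ℓ) (a - (n + 1))
      have hmem : addPoly ℓ (1 / x (a - (n + 1))) ∈ M := by
        rw [hstep, one_div]
        have := hM (a - (n + 1) + 1) (by omega) (by omega)
        exact M.inv_mem (add_mem (pow_mem this _) this)
      obtain ⟨M', S', hMM, hy, hS', hMS'⟩ := exists_extension h.two_le _ M hMS hmem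
      refine ⟨M', S', fun j hj hj' => ?_, ?_, hMS'⟩
      · rcases eq_or_ne j (a - (n + 1)) with rfl | hne
        · simpa using M'.inv_mem hy
        · exact hMM (hM j (by omega) hj')
      · rw [pow_succ]; exact hS'.trans (Nat.mul_le_mul_right _ hS)
  obtain ⟨b, rfl⟩ := Nat.exists_eq_add_of_le ha
  clear ha
  induction b with
  | zero =>
    obtain ⟨M, S, hM, hS⟩ := hdown a le_rfl
    exact ⟨M, S, fun j hj => hM j (by omega) hj, hS⟩
  | succ b ih =>
    obtain ⟨M, S, hM, hS, hMS⟩ := ih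
    have hmem : addPoly ℓ (x (a + b + 1)) ∈ M := by
      rw [h.addPoly_succ]
      have := hM (a + b) le_rfl
      exact div_mem (pow_mem this _) (add_mem (one_mem _) (pow_mem this _))
    obtain ⟨M', S', hMM, hy, hS', hMS'⟩ := exists_extension h.two_le _ M hMS hmem
    refine ⟨M', S', fun j hj => ?_, ?_, hMS'⟩
    · rcases eq_or_ne j (a + b + 1) with rfl | hne
      · exact hy
      · exact hMM (hM j (by omega))
    · rw [← add_assoc, pow_succ]; exact hS'.trans (Nat.mul_le_mul_right _ hS)

lemma towerRing_le (_h : GSTower k ℓ x) {i : ℕ} {M : IntermediateField k L}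
    (hM : ∀ j ≤ i, x j ∈ M) : towerRing k ℓ x i ≤ M.toSubalgebra := by
  induction i with
  | zero =>
    refine Algebra.adjoin_le ?_
    have := hM 0 le_rfl
    rintro f (rfl | rfl)
    · exact this
    · exact M.inv_mem (add_mem (pow_mem this _) this)
  | succ i ih =>
    intro f hf
    obtain ⟨P, rfl⟩ := _h.mem_towerRing_succ.1 hf
    rw [aeval_eq_sum_range]
    refine sum_mem fun j _ => ?_
    rw [Algebra.smul_def]
    exact mul_mem (ih (fun j hj => hM j (by omega)) (SetLike.coe_mem _))
      (pow_mem (hM _ le_rfl) _)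

lemma card_le_of_linearIndependent (h : GSTower k ℓ x) {a i : ℕ} (ha : a ≤ i) {ι : Type*}
    [Fintype ι] {v : ι → L} (hv : ∀ s, v s ∈ towerRing k ℓ x i)
    (hli : LinearIndependent k⟮x a⟯ v) : Fintype.card ι ≤ ℓ ^ i := by
  obtain ⟨M, S, hM, hS, hMS⟩ := h.exists_field ha
  rw [← finrank_span_eq_card hli]
  have : FiniteDimensional k⟮x a⟯ (Submodule.span k⟮x a⟯ (S : Set L)) :=
    FiniteDimensional.span_finset _ S
  refine (Submodule.finrank_mono (Submodule.span_le.2 ?_)).trans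
    ((finrank_span_finset_le_card S).trans hS)
  rintro _ ⟨s, rfl⟩
  exact hMS (h.towerRing_le hM (hv s))

/-- Regular functions at level `i` vanishing where `x (i + 1)` has a pole and `x a` specializes
to `ω`. -/
def rootIdeal (k : Type*) {L : Type*} [Field k] [Field L] [Algebra k L] (ℓ : ℕ) (x : ℕ → L)
    (i a : ℕ) (ω : k) : Submodule k L where
  carrier := {f | f ∈ regRing k ℓ x i ∧ ∀ A : ValuationSubring L, IsOver k A → x 0 ∈ A →
    A.valuation (1 + x a ^ (ℓ - 1)) < 1 →
    A.valuation (x a - algebraMap k L ω) = A.valuation (1 + x a ^ (ℓ - 1)) →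
    f * addPoly ℓ (x (i + 1)) ∈ A}
  zero_mem' := ⟨zero_mem _, fun A _ _ _ _ => by rw [zero_mul]; exact zero_mem A⟩
  add_mem' hf hg := ⟨add_mem hf.1 hg.1, fun A hA h0 hv hω => by
    rw [add_mul]; exact add_mem (hf.2 A hA h0 hv hω) (hg.2 A hA h0 hv hω)⟩
  smul_mem' c f hf := ⟨Subalgebra.smul_mem _ hf.1 c, fun A hA h0 hv hω => by
    rw [smul_mul_assoc, Algebra.smul_def]; exact mul_mem (hA c) (hf.2 A hA h0 hv hω)⟩

lemma aeval_mem {A : ValuationSubring L} (hA : IsOver k A) {y : L} (hy : y ∈ A) (P : k[X]) :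
    aeval y P ∈ A := by
  rw [aeval_eq_sum_range]
  refine sum_mem fun j _ => ?_
  rw [Algebra.smul_def]
  exact mul_mem (hA _) (pow_mem hy _)

lemma eval_eq_zero_of_relation (h : GSTower k ℓ x) {a i : ℕ} (ha : a ≤ i) {ω : k} {ι : Type*}
    [Fintype ι] {f : ι → L} (hf : ∀ s, f s ∈ regRing k ℓ x i)
    (hind : ∀ c : ι → k, ∑ s, c s • f s ∈ rootIdeal k ℓ x i a ω → c = 0)
    {P : ι → ℕ → k[X]}
    (hP : ∑ j ∈ Finset.range (ℓ ^ (i - a)), ∑ s,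
      aeval (x a) (P s j) * (f s * (addPoly ℓ (x (i + 1)))⁻¹ ^ j) = 0)
    {j : ℕ} (hj : j < ℓ ^ (i - a)) (s : ι) : (P s j).eval ω = 0 := by
  induction j using Nat.strong_induction_on generalizing s with
  | _ j ih =>
  refine congrFun (hind (fun s => (P s j).eval ω)
    ⟨sum_mem fun s _ => Subalgebra.smul_mem _ (hf s) _, fun A hA h0 hv hω => ?_⟩) s
  have hu0 := h.addPoly_ne_zero (i + 1)
  set u := addPoly ℓ (x (i + 1)) with hu
  obtain ⟨hgt, hval⟩ := h.val_gt_of_pole A.valuation hv (j := i + 1) (by omega)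
  have huv : A.valuation u = A.valuation (x (i + 1)) ^ ℓ :=
    val_addPoly_of_gt _ h.two_le hgt
  have hu1 : 1 ≤ A.valuation u := by rw [huv]; exact one_le_pow₀ hgt.le
  have huθ : A.valuation u ^ ℓ ^ (i - a) * A.valuation (x a - algebraMap k L ω) = 1 := by
    rw [huv, ← pow_mul, ← pow_succ', ← Nat.sub_add_comm ha, hval, hω]
    exact inv_mul_cancel₀ ((Valuation.ne_zero_iff _).2 (h.one_add_ne_zero a))
  have hui : u⁻¹ ∈ A := by
    rw [← A.valuation_le_one_iff, map_inv₀]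
    exact inv_le_one_of_one_le₀ hu1
  have hxa : x a ∈ A := by
    rw [← sub_add_cancel (x a) (algebraMap k L ω)]
    refine add_mem ?_ (hA ω)
    rw [← A.valuation_le_one_iff, hω]
    exact hv.le
  have hxω : (x a - algebraMap k L ω) * u ^ (j + 1) ∈ A := by
    rw [← A.valuation_le_one_iff, map_mul, map_pow, ← huθ, mul_comm]
    exact mul_le_mul_left (pow_le_pow_right₀ hu1 hj) _
  have hdiff : ∀ Q : k[X], (aeval (x a) Q - algebraMap k L (Q.eval ω)) * u ^ (j + 1) ∈ A := by
    intro Q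
    obtain ⟨R, hR⟩ := X_sub_C_dvd_sub_C_eval (p := Q) (a := ω)
    have := congrArg (aeval (x a)) hR
    rw [map_sub, map_mul, map_sub, aeval_X, aeval_C, aeval_C] at this
    rw [this, mul_right_comm]
    exact mul_mem hxω (aeval_mem hA hxa R)
  have key : (∑ s, (P s j).eval ω • f s) * u = -∑ j' ∈ Finset.range (ℓ ^ (i - a)), ∑ s,
      (aeval (x a) (P s j') - if j' = j then algebraMap k L ((P s j).eval ω) else 0) *
        u ^ (j + 1) * (f s * u⁻¹ ^ j') := by
    have e1 : ∀ j' s, (aeval (x a) (P s j') -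
        if j' = j then algebraMap k L ((P s j).eval ω) else 0) * u ^ (j + 1) * (f s * u⁻¹ ^ j') =
        u ^ (j + 1) * (aeval (x a) (P s j') * (f s * u⁻¹ ^ j')) -
          if j' = j then (P s j).eval ω • f s * u else 0 := by
      intro j' s
      split_ifs with hjj
      · subst hjj
        have : u ^ (j' + 1) * u⁻¹ ^ j' = u := by
          rw [pow_succ', mul_assoc, ← mul_pow, mul_inv_cancel₀ hu0, one_pow, mul_one]
        rw [Algebra.smul_def]
        linear_combination (-(algebraMap k L (eval ω (P s j')) * f s)) * this
      · ring
    simp only [e1, Finset.sum_sub_distrib, ← Finset.mul_sum]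
    rw [hP, Finset.sum_comm (s := Finset.range _)]
    simp only [Finset.sum_ite_eq', Finset.mem_range, hj, if_true]
    rw [Finset.sum_mul]
    ring
  rw [key]
  refine neg_mem (sum_mem fun j' _ => sum_mem fun s _ => ?_)
  have hfs := (hf s).2 A hA h0
  rcases lt_trichotomy j' j with hlt | rfl | hlt
  · rw [if_neg hlt.ne]
    have := hdiff (P s j')
    rw [ih j' hlt (hlt.trans hj), map_zero] at this
    exact mul_mem this (mul_mem hfs (pow_mem hui _))
  · rw [if_pos rfl]
    exact mul_mem (hdiff _) (mul_mem hfs (pow_mem hui _))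
  · rw [if_neg hlt.ne', sub_zero]
    obtain ⟨m, rfl⟩ := Nat.exists_eq_add_of_lt hlt
    rw [show aeval (x a) (P s (j + m + 1)) * u ^ (j + 1) * (f s * u⁻¹ ^ (j + m + 1)) =
      aeval (x a) (P s (j + m + 1)) * (f s * u⁻¹ ^ m) by
        have : u ^ (j + 1) * u⁻¹ ^ (j + 1) = 1 := by
          rw [← mul_pow, mul_inv_cancel₀ hu0, one_pow]
        rw [show j + m + 1 = m + (j + 1) by ring, pow_add]
        linear_combination (aeval (x a) (P s (m + (j + 1))) * f s * u⁻¹ ^ m) * this]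
    exact mul_mem (aeval_mem hA hxa _) (mul_mem hfs (pow_mem hui _))

lemma card_le_pow (h : GSTower k ℓ x) {a i : ℕ} (ha : a ≤ i) {ω : k} {ι : Type*}
    [Fintype ι] {f : ι → L} (hf : ∀ s, f s ∈ regRing k ℓ x i)
    (hω : x a - algebraMap k L ω ≠ 0)
    (hind : ∀ c : ι → k, ∑ s, c s • f s ∈ rootIdeal k ℓ x i a ω → c = 0) :
    Fintype.card ι ≤ ℓ ^ a := by
  have hli : LinearIndependent k⟮x a⟯ fun p : ι × Fin (ℓ ^ (i - a)) =>
      f p.1 * (addPoly ℓ (x (i + 1)))⁻¹ ^ (p.2 : ℕ) := by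
    refine linearIndependent_adjoin hω fun P hP p => ?_
    let Q : ι → ℕ → k[X] := fun s j => if hj : j < ℓ ^ (i - a) then P (s, ⟨j, hj⟩) else 0
    have hQ : ∀ s (j : Fin (ℓ ^ (i - a))), Q s j = P (s, j) := fun s j => dif_pos j.2
    rw [← Prod.mk.eta (p := p), ← hQ]
    refine h.eval_eq_zero_of_relation ha hf hind ?_ p.2.2 p.1
    rw [Finset.sum_range, Finset.sum_comm, ← hP, Fintype.sum_prod_type]
    simp only [hQ]
  have hinv : (addPoly ℓ (x (i + 1)))⁻¹ ∈ towerRing k ℓ x i := by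
    rw [h.addPoly_succ, inv_div, div_eq_mul_inv, ← inv_pow]
    exact mul_mem (add_mem (one_mem _) (pow_mem (h.mem_towerRing_self i) _))
      (pow_mem (h.inv_mem le_rfl) _)
  have hcard : Fintype.card (ι × Fin (ℓ ^ (i - a))) ≤ ℓ ^ i :=
    h.card_le_of_linearIndependent ha (fun p => mul_mem (hf p.1).1 (pow_mem hinv _)) hli
  rw [Fintype.card_prod, Fintype.card_fin] at hcard
  refine Nat.le_of_mul_le_mul_right (hcard.trans_eq ?_)
    (pow_pos (by have := h.two_le; omega : 0 < ℓ) (i - a))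
  rw [← pow_add, Nat.add_sub_cancel' ha]

end GSTower

section

variable {k L : Type*} [Field k] [Field L] [Algebra k L]

lemma finrank_le_of_forall_card_le {V J : Submodule k L} [FiniteDimensional k V] {B : ℕ}
    (hB : ∀ (n : ℕ) (f : Fin n → L), (∀ s, f s ∈ V) →
      (∀ c : Fin n → k, ∑ s, c s • f s ∈ J → c = 0) → n ≤ B) :
    Module.finrank k V ≤ Module.finrank k ↥(V ⊓ J) + B := by
  let φ : V →ₗ[k] L ⧸ J := J.mkQ ∘ₗ V.subtype
  have h1 := φ.finrank_range_add_finrank_ker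
  have hker : φ.ker = J.comap V.subtype := by rw [LinearMap.ker_comp, Submodule.ker_mkQ]
  have h2 : Module.finrank k φ.ker = Module.finrank k ↥(V ⊓ J) := by
    rw [hker, ← Submodule.map_comap_subtype, Submodule.finrank_map_subtype_eq]
  let b := Module.finBasis k φ.range
  choose f hf using fun s => (b s).2
  have h3 : Module.finrank k φ.range ≤ B := by
    refine hB _ (fun s => (f s : L)) (fun s => (f s).2) fun c hc => ?_
    have h4 : ∑ s, c s • b s = 0 := by
      refine Subtype.ext ?_
      rw [AddSubmonoidClass.coe_finsetSum]
      simp only [SetLike.val_smul, ← hf, ← map_smul, ← map_sum]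
      refine (Submodule.Quotient.mk_eq_zero J).2 ?_
      simpa using hc
    exact funext (Fintype.linearIndependent_iff.1 b.linearIndependent c h4)
  omega

lemma finrank_le_finset_inf {σ : Type*} (T : Finset σ) {J : σ → Submodule k L} {B : σ → ℕ}
    {V : Submodule k L} [FiniteDimensional k V]
    (hB : ∀ t ∈ T, ∀ W ≤ V, Module.finrank k W ≤ Module.finrank k ↥(W ⊓ J t) + B t) :
    Module.finrank k V ≤ Module.finrank k ↥(V ⊓ T.inf J) + ∑ t ∈ T, B t := by
  classical
  induction T using Finset.induction_on with
  | empty => rw [Finset.inf_empty, inf_top_eq]; exact Nat.le_add_right _ _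
  | insert t T ht ih =>
    rw [Finset.sum_insert ht, Finset.inf_insert, inf_left_comm, inf_comm]
    have h1 := ih fun t ht => hB t (Finset.mem_insert_of_mem ht)
    have h2 := hB t (Finset.mem_insert_self _ _) (V ⊓ T.inf J) inf_le_left
    omega

end

namespace GSTower

variable {k L : Type*} [Field k] [Field L] [Algebra k L] {ℓ : ℕ} {x : ℕ → L}

lemma sub_const_ne_zero (h : GSTower k ℓ x) (i : ℕ) (c : k) : x i - algebraMap k L c ≠ 0 := by
  intro h0
  obtain ⟨A, hA, hA0⟩ := h.exists_infinite
  have hv := h.val_gt A.valuation (not_le.1 (mt (A.valuation_le_one_iff _).1 hA0)) i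
  rw [sub_eq_zero.1 h0] at hv
  exact hv.not_ge (hA.val_const_le c)

lemma finrank_le_rootIdeal (h : GSTower k ℓ x) {a i : ℕ} (ha : a ≤ i) (ω : k)
    {V : Submodule k L} [FiniteDimensional k V]
    (hV : V ≤ Subalgebra.toSubmodule (regRing k ℓ x i)) :
    Module.finrank k V ≤ Module.finrank k ↥(V ⊓ rootIdeal k ℓ x i a ω) + ℓ ^ a :=
  finrank_le_of_forall_card_le fun n f hf hind => by
    simpa using h.card_le_pow ha (fun s => hV (hf s)) (h.sub_const_ne_zero a ω) hind

lemma sum_pow_le (h : GSTower k ℓ x) (n : ℕ) :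
    ∑ a ∈ Finset.range n, (ℓ - 1) * ℓ ^ a = ℓ ^ n - 1 := by
  obtain ⟨l, rfl⟩ := Nat.exists_eq_add_of_le h.two_le
  induction n with
  | zero => simp
  | succ n ih =>
    rw [Finset.sum_range_succ, ih, pow_succ]
    have := Nat.one_le_pow n (2 + l) (by omega)
    rw [show 2 + l - 1 = 1 + l by omega]
    have : (2 + l) ^ n * (2 + l) = (1 + l) * (2 + l) ^ n + (2 + l) ^ n := by ring
    omega

lemma finrank_le_earlyIdeal (h : GSTower k ℓ x) (i : ℕ) (V : Submodule k L)
    (hVfin : FiniteDimensional k V) (hV : V ≤ Subalgebra.toSubmodule (regRing k ℓ x i)) :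
    Module.finrank k V ≤ Module.finrank k ↥(V ⊓ earlyIdeal k ℓ x i) + (ℓ ^ (i / 2 + 1) - 1) := by
  classical
  have hℓ := h.two_le
  let T := Finset.range (i / 2 + 1) ×ˢ (nthRoots (ℓ - 1) (-1 : k)).toFinset
  have h1 := finrank_le_finset_inf (V := V) T (J := fun t => rootIdeal k ℓ x i t.1 t.2)
    (B := fun t => ℓ ^ t.1) fun t ht W hW => by
      have : FiniteDimensional k W := Submodule.finiteDimensional_of_le hW
      have ht' := Finset.mem_range.1 (Finset.mem_product.1 ht).1
      exact h.finrank_le_rootIdeal (by omega) _ (hW.trans hV)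
  have h2 : ∑ t ∈ T, ℓ ^ t.1 ≤ ℓ ^ (i / 2 + 1) - 1 := by
    rw [← h.sum_pow_le, Finset.sum_product]
    refine Finset.sum_le_sum fun a _ => ?_
    rw [Finset.sum_const (ℓ ^ a), smul_eq_mul]
    exact Nat.mul_le_mul_right _ ((Multiset.toFinset_card_le _).trans (card_nthRoots _ _))
  have h3 : V ⊓ T.inf (fun t => rootIdeal k ℓ x i t.1 t.2) ≤ V ⊓ earlyIdeal k ℓ x i := by
    refine fun f hf => ⟨hf.1, hV hf.1, fun A hA h0 a ha hv => ?_⟩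
    obtain ⟨ω, hω0, hωT, hω⟩ := h.exists_root_of_pole hA hv
    have hroot : ω ^ (ℓ - 1) = -1 := by
      rw [addPoly, ← Nat.sub_add_cancel (show 1 ≤ ℓ by omega), pow_succ] at hωT
      have : (ω ^ (ℓ - 1) + 1) * ω = 0 := by linear_combination hωT
      exact eq_neg_of_add_eq_zero_left ((mul_eq_zero.1 this).resolve_right hω0)
    have hmem : (a, ω) ∈ T := Finset.mem_product.2 ⟨Finset.mem_range.2 (by simp only; omega),
      Multiset.mem_toFinset.2 ((mem_nthRoots (by omega)).2 hroot)⟩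
    exact ((Finset.inf_le (f := fun t : ℕ × k => rootIdeal k ℓ x i t.1 t.2) hmem) hf.2).2
      A hA h0 hv hω
  have h4 := Submodule.finrank_mono h3
  omega

/-- The gap bound for the level-`i` functions whose only poles are over infinity. -/
lemma gap (h : GSTower k ℓ x) (i n : ℕ) :
    n ≤ Module.finrank k ↥(Subalgebra.toSubmodule (regRing k ℓ x i) ⊓
      polarFil k (x 0) (x i) n) + (ℓ ^ ((i + 2) / 2) - 1) * (ℓ ^ ((i + 1) / 2) - 1) :=
  h.gap_of_codim h.finrank_le_earlyIdeal i n

end GSTower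

section

variable {k L : Type*} [Field k] [Field L] [Algebra k L]

lemma exists_algHom_of_le_range {R : Type*} [CommRing R] [Algebra k R] (f : R →ₐ[k] L)
    (g : R →ₐ[k] k) (hfg : ∀ a, f a = 0 → g a = 0) {E : Subalgebra k L} (hE : E ≤ f.range) :
    ∃ φ : E →ₐ[k] k, ∀ a (ha : f a ∈ E), φ ⟨f a, ha⟩ = g a := by
  have H : RingHom.ker f.rangeRestrict.toRingHom ≤ RingHom.ker g.toRingHom := fun a ha =>
    hfg a (congrArg Subtype.val ha)
  exact ⟨(AlgHom.liftOfSurjective f.rangeRestrict f.rangeRestrict_surjective g H).comp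
    (Subalgebra.inclusion hE), fun a _ =>
    AlgHom.liftOfSurjective_apply f.rangeRestrict f.rangeRestrict_surjective g H a⟩

end

namespace GSTower

variable {k L : Type*} [Field k] [Field L] [Algebra k L] {ℓ : ℕ} {x : ℕ → L}

lemma const_add_pow (h : GSTower k ℓ x) (a b : k) : (a + b) ^ ℓ = a ^ ℓ + b ^ ℓ := by
  apply (algebraMap k L).injective
  simpa using h.add_pow (algebraMap k L a) (algebraMap k L b)

lemma const_pow_pow (h : GSTower k ℓ x) (a : k) : (a ^ ℓ) ^ ℓ = a := by
  have := h.finite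
  have := Fintype.ofFinite k
  rw [← pow_mul, ← sq, ← h.card, Nat.card_eq_fintype_card, FiniteField.pow_card]

lemma addPoly_pow (h : GSTower k ℓ x) (a : k) : addPoly ℓ a ^ ℓ = addPoly ℓ a := by
  rw [addPoly, h.const_add_pow, h.const_pow_pow, add_comm]

lemma card_fiber (h : GSTower k ℓ x) [Fintype k] [DecidableEq k] {z : k} (hz : z ^ ℓ = z) :
    (Finset.univ.filter fun β : k => addPoly ℓ β = z).card = ℓ := by
  have hℓ := h.two_le
  have hle : ∀ w : k, (Finset.univ.filter fun β : k => addPoly ℓ β = w).card ≤ ℓ := fun w => by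
    let Q : k[X] := X ^ ℓ + (X - C w)
    have hQ : Q.Monic := by
      apply monic_X_pow_add
      rw [degree_X_sub_C]
      exact_mod_cast hℓ
    have hQd : Q.natDegree = ℓ := by
      rw [natDegree_add_eq_left_of_natDegree_lt, natDegree_X_pow]
      rw [natDegree_X_sub_C, natDegree_X_pow]
      exact hℓ
    refine le_trans ?_ ((Multiset.toFinset_card_le _).trans ((card_roots' Q).trans hQd.le))
    refine Finset.card_le_card fun β hβ => ?_
    have hβ' := (Finset.mem_filter.1 hβ).2
    rw [Multiset.mem_toFinset, mem_roots hQ.ne_zero, IsRoot.def]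
    simp only [Q, eval_add, eval_sub, eval_X, eval_C, eval_pow]
    rw [← hβ', addPoly]
    ring
  have hfix : (Finset.univ.filter fun w : k => w ^ ℓ = w).card ≤ ℓ := by
    have hQd := FiniteField.X_pow_card_sub_X_natDegree_eq k hℓ
    have hQ0 := FiniteField.X_pow_card_sub_X_ne_zero k hℓ
    refine le_trans ?_ ((Multiset.toFinset_card_le _).trans ((card_roots' _).trans hQd.le))
    refine Finset.card_le_card fun β hβ => ?_
    have hβ' := (Finset.mem_filter.1 hβ).2
    rw [Multiset.mem_toFinset, mem_roots hQ0, IsRoot.def]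
    simp [hβ']
  refine le_antisymm (hle z) ?_
  by_contra! hlt
  have hsum := Finset.card_eq_sum_card_fiberwise (f := addPoly ℓ) (s := (Finset.univ : Finset k))
    (t := Finset.univ.filter fun w : k => w ^ ℓ = w) fun a _ => by
      simpa using h.addPoly_pow a
  have hlt' := Finset.sum_lt_sum (s := Finset.univ.filter fun w : k => w ^ ℓ = w)
    (f := fun w => (Finset.univ.filter fun β : k => addPoly ℓ β = w).card) (g := fun _ => ℓ)
    (fun w _ => hle w) ⟨z, by simpa using hz, hlt⟩
  rw [Finset.sum_const, smul_eq_mul] at hlt'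
  rw [Finset.card_univ, ← Nat.card_eq_fintype_card, h.card] at hsum
  have := Nat.mul_le_mul_right ℓ hfix
  nlinarith

lemma exists_point_zero (h : GSTower k ℓ x) {α : k} (hα : addPoly ℓ α ≠ 0) :
    ∃ φ : towerRing k ℓ x 0 →ₐ[k] k, φ ⟨x 0, h.mem_towerRing_self 0⟩ = α := by
  let T : k[X] := X ^ ℓ + X
  have hTx : aeval (x 0) T = addPoly ℓ (x 0) := by simp [T, addPoly]
  have hTα : aeval α T = addPoly ℓ α := by simp [T, addPoly]
  have hf : ∀ y : Submonoid.powers T, IsUnit (aeval (x 0) (y : k[X])) := by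
    rintro ⟨_, n, rfl⟩
    change IsUnit (aeval (x 0) (T ^ n))
    rw [map_pow, hTx]
    exact (isUnit_iff_ne_zero.2 (h.addPoly_ne_zero 0)).pow n
  have hg : ∀ y : Submonoid.powers T, IsUnit (aeval α (y : k[X])) := by
    rintro ⟨_, n, rfl⟩
    change IsUnit (aeval α (T ^ n))
    rw [map_pow, hTα]
    exact (isUnit_iff_ne_zero.2 hα).pow n
  let f : Localization (Submonoid.powers T) →ₐ[k] L := IsLocalization.liftAlgHom hf
  let g : Localization (Submonoid.powers T) →ₐ[k] k := IsLocalization.liftAlgHom hg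
  have hfP : ∀ P : k[X], f (algebraMap _ _ P) = aeval (x 0) P := fun P =>
    IsLocalization.lift_eq _ P
  have hgP : ∀ P : k[X], g (algebraMap _ _ P) = aeval α P := fun P =>
    IsLocalization.lift_eq _ P
  have hE : towerRing k ℓ x 0 ≤ f.range := by
    refine Algebra.adjoin_le ?_
    rintro y (rfl | rfl)
    · exact ⟨algebraMap k[X] _ X, (hfP X).trans (aeval_X _)⟩
    · let t : Submonoid.powers T := ⟨T, Submonoid.mem_powers T⟩
      refine ⟨IsLocalization.mk' _ 1 t, ?_⟩
      change f _ = _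
      refine eq_inv_of_mul_eq_one_left ?_
      rw [← hTx, ← hfP, ← map_mul]
      exact (congrArg f (IsLocalization.mk'_spec _ 1 t)).trans ((hfP 1).trans (map_one _))
  obtain ⟨φ, hφ⟩ := exists_algHom_of_le_range f g (fun a ha => by
    obtain ⟨P, s, rfl⟩ := IsLocalization.exists_mk'_eq (Submonoid.powers T) a
    have h1 : f (IsLocalization.mk' _ P s * algebraMap _ _ (s : k[X])) = 0 := by
      rw [map_mul, ha, zero_mul]
    rw [IsLocalization.mk'_spec, hfP] at h1
    have hP : P = 0 := transcendental_iff_injective.1 h.transcendental (h1.trans (map_zero _).symm)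
    rw [hP, IsLocalization.mk'_zero, map_zero]) hE
  refine ⟨φ, ?_⟩
  have h2 := hφ (algebraMap _ _ X) (by
    rw [hfP, aeval_X]; exact h.mem_towerRing_self 0)
  refine (congrArg φ (Subtype.ext ?_)).trans (h2.trans ((hgP X).trans (aeval_X _)))
  exact ((hfP X).trans (aeval_X _)).symm

lemma exists_point_succ (h : GSTower k ℓ x) {i : ℕ} (φ : towerRing k ℓ x i →ₐ[k] k) {β : k}
    (hβ : addPoly ℓ β = φ ⟨addPoly ℓ (x (i + 1)), h.addPoly_succ_mem i⟩) :
    ∃ ψ : towerRing k ℓ x (i + 1) →ₐ[k] k,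
      ψ ⟨x (i + 1), h.mem_towerRing_self (i + 1)⟩ = β ∧
      ψ.comp (Subalgebra.inclusion (h.towerRing_le_succ i)) = φ := by
  let f : (towerRing k ℓ x i)[X] →ₐ[k] L := (aeval (x (i + 1))).restrictScalars k
  let g : (towerRing k ℓ x i)[X] →ₐ[k] k := eval₂AlgHom φ β fun a => Commute.all _ _
  have hgX : g X = β := eval₂_X _ _
  have hgC : ∀ a, g (C a) = φ a := fun a => eval₂_C _ _
  obtain ⟨ψ, hψ⟩ := exists_algHom_of_le_range f g (fun P hP => by
    have hsum := h.aeval_eq_sum i P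
    rw [show aeval (x (i + 1)) P = 0 from hP] at hsum
    have hmod : P %ₘ h.stepPoly i = 0 := by
      ext j
      by_cases hj : j < ℓ
      · simpa using h.eq_zero_of_sum_eq_zero
          (c := fun j => ((P %ₘ h.stepPoly i).coeff j : L)) (fun j => SetLike.coe_mem _)
          hsum.symm hj
      · rw [coeff_eq_zero_of_natDegree_lt
          ((h.natDegree_modByMonic_lt' i P).trans_le (not_lt.1 hj)), coeff_zero]
    rw [← modByMonic_add_div P (h.stepPoly i), hmod, zero_add, map_mul]
    have : g (h.stepPoly i) = 0 := by
      rw [stepPoly, map_add, map_sub, map_pow, hgX, hgC, ← hβ, addPoly]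
      ring
    rw [this, zero_mul]) (E := towerRing k ℓ x (i + 1)) fun y hy => h.mem_towerRing_succ.1 hy
  refine ⟨ψ, ?_, ?_⟩
  · have h2 := hψ X (by
      rw [show f X = x (i + 1) from aeval_X _]; exact h.mem_towerRing_self (i + 1))
    rw [hgX] at h2
    rw [← h2]
    congr 2
    exact (aeval_X _).symm
  · ext ⟨a, ha⟩
    have hfa : f (C ⟨a, ha⟩) = a := aeval_C _ _
    have h2 := hψ (C ⟨a, ha⟩) (by rw [hfa]; exact h.towerRing_le_succ i ha)
    rw [hgC] at h2
    rw [← h2, AlgHom.comp_apply]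
    exact congrArg ψ (Subtype.ext hfa.symm)

lemma point_addPoly_succ (h : GSTower k ℓ x) {i : ℕ} (φ : towerRing k ℓ x i →ₐ[k] k) :
    φ ⟨addPoly ℓ (x (i + 1)), h.addPoly_succ_mem i⟩ ^ ℓ =
      φ ⟨addPoly ℓ (x (i + 1)), h.addPoly_succ_mem i⟩ := by
  have hℓ := h.two_le
  set z := φ ⟨addPoly ℓ (x (i + 1)), h.addPoly_succ_mem i⟩ with hz
  set α := φ ⟨x i, h.mem_towerRing_self i⟩ with hα
  have e1 : z * (1 + α ^ (ℓ - 1)) = α ^ ℓ := by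
    rw [hz, hα, ← map_pow, ← map_pow, ← map_one φ, ← map_add, ← map_mul]
    exact congrArg φ (Subtype.ext (h.step i))
  have e2 : z * addPoly ℓ α = α ^ ℓ * α := by
    rw [← e1, addPoly]
    nth_rewrite 1 [← Nat.sub_add_cancel (show 1 ≤ ℓ by omega)]
    rw [pow_succ]
    ring
  have hu : φ (⟨addPoly ℓ (x i), add_mem (pow_mem (h.mem_towerRing_self i) _)
      (h.mem_towerRing_self i)⟩) * φ ⟨(addPoly ℓ (x i))⁻¹, h.inv_addPoly_mem i⟩ = 1 := by
    rw [← map_mul, ← map_one φ]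
    exact congrArg φ (Subtype.ext (mul_inv_cancel₀ (h.addPoly_ne_zero i)))
  have hT : φ (⟨addPoly ℓ (x i), add_mem (pow_mem (h.mem_towerRing_self i) _)
      (h.mem_towerRing_self i)⟩) = addPoly ℓ α := by
    rw [hα]
    change φ _ = φ _ ^ ℓ + φ _
    rw [← map_pow, ← map_add]
    rfl
  rw [hT] at hu
  refine mul_right_cancel₀ (left_ne_zero_of_mul_eq_one hu) ?_
  rw [e2, ← h.addPoly_pow, ← mul_pow, e2, mul_pow, h.const_pow_pow, mul_comm]

lemma exists_points (h : GSTower k ℓ x) (i : ℕ) :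
    ∃ p : Fin ((ℓ ^ 2 - ℓ) * ℓ ^ i) → (towerRing k ℓ x i →ₐ[k] k), Function.Injective p := by
  classical
  have := h.finite
  have := Fintype.ofFinite k
  have hℓ := h.two_le
  induction i with
  | zero =>
    have hcard : (Finset.univ.filter fun α : k => ¬ addPoly ℓ α = 0).card = ℓ ^ 2 - ℓ := by
      have h1 := Finset.card_filter_add_card_filter_not (s := (Finset.univ : Finset k))
        (fun α => addPoly ℓ α = 0)
      rw [h.card_fiber (zero_pow (by omega)), Finset.card_univ, ← Nat.card_eq_fintype_card,
        h.card] at h1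
      omega
    rw [pow_zero, mul_one, ← hcard]
    let e := (Finset.univ.filter fun α : k => ¬ addPoly ℓ α = 0).equivFin.symm
    choose p hp using fun t => h.exists_point_zero (Finset.mem_filter.1 (e t).2).2
    refine ⟨p, fun s t hst => e.injective (Subtype.ext ?_)⟩
    rw [← hp s, ← hp t, hst]
  | succ i ih =>
    obtain ⟨p, hp⟩ := ih
    have hroots := fun t => h.card_fiber (h.point_addPoly_succ (p t))
    let e := fun t => (Finset.equivFinOfCardEq (hroots t)).symm
    choose r hr hr' using fun (t : Fin ((ℓ ^ 2 - ℓ) * ℓ ^ i)) (j : Fin ℓ) =>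
      h.exists_point_succ (p t) (Finset.mem_filter.1 (e t j).2).2
    have hexp : (ℓ ^ 2 - ℓ) * ℓ ^ (i + 1) = (ℓ ^ 2 - ℓ) * ℓ ^ i * ℓ := by
      rw [pow_succ ℓ i, mul_assoc]
    rw [hexp]
    have hinj : ∀ a b : Fin ((ℓ ^ 2 - ℓ) * ℓ ^ i) × Fin ℓ, r a.1 a.2 = r b.1 b.2 → a = b := by
      rintro ⟨a₁, a₂⟩ ⟨b₁, b₂⟩ hab
      dsimp only at hab
      obtain rfl : a₁ = b₁ := hp (by rw [← hr' a₁ a₂, ← hr' b₁ b₂, hab])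
      have : e a₁ a₂ = e a₁ b₂ := Subtype.ext (by rw [← hr a₁ a₂, ← hr a₁ b₂, hab])
      rw [(e a₁).injective this]
    exact ⟨fun t => r (finProdFinEquiv.symm t).1 (finProdFinEquiv.symm t).2, fun a b hab =>
      finProdFinEquiv.symm.injective (hinj _ _ hab)⟩

lemma exists_denominator (h : GSTower k ℓ x) (i : ℕ) :
    ∃ s ∈ regRing k ℓ x i, s ≠ 0 ∧ s⁻¹ ∈ towerRing k ℓ x i ∧
      ∀ f ∈ towerRing k ℓ x i, ∃ M, s ^ M * f ∈ regRing k ℓ x i := by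
  induction i with
  | zero =>
    have hreg : ∀ P : k[X], aeval (x 0) P ∈ regRing k ℓ x 0 := fun P => by
      have h0 : x 0 ∈ regRing k ℓ x 0 := ⟨h.mem_towerRing_self 0, fun _ _ h0 => h0⟩
      exact Algebra.adjoin_le (Set.singleton_subset_iff.2 h0) (aeval_mem_adjoin_singleton k (x 0))
    have hT : addPoly ℓ (x 0) = aeval (x 0) (X ^ ℓ + X : k[X]) := by simp [addPoly]
    refine ⟨addPoly ℓ (x 0), hT ▸ hreg _, h.addPoly_ne_zero 0, h.inv_addPoly_mem 0,
      fun f hf => ?_⟩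
    obtain ⟨N, P, hP⟩ := h.exists_pow_mul_eq_aeval hf
    exact ⟨N, by rw [mul_comm, hP]; exact hreg P⟩
  | succ i ih =>
    obtain ⟨s, hs, hs0, hsi, hsf⟩ := ih
    have hle := h.towerRing_le_succ i
    have hpole : poleProd ℓ x (i + 1) ∈ towerRing k ℓ x (i + 1) := h.poleProd_mem (by omega)
    have hreg : ∀ j ≤ ℓ, poleProd ℓ x (i + 1) * x (i + 1) ^ j ∈ regRing k ℓ x (i + 1) :=
      fun j hj => ⟨mul_mem hpole (pow_mem (h.mem_towerRing_self _) _), fun A _ h0 =>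
        (A.valuation_le_one_iff _).1
          (h.val_poleProd_mul_pow_le A.valuation ((A.valuation_le_one_iff _).2 h0) (i + 1) hj)⟩
    have hpR : poleProd ℓ x (i + 1) ∈ regRing k ℓ x (i + 1) := by
      simpa using hreg 0 (Nat.zero_le _)
    have hR : regRing k ℓ x i ≤ regRing k ℓ x (i + 1) := inf_le_inf_right _ hle
    have hsR := hR hs
    refine ⟨s * poleProd ℓ x (i + 1), mul_mem hsR hpR, mul_ne_zero hs0 (h.poleProd_ne_zero _),
      ?_, fun f hf => ?_⟩
    · rw [mul_inv]
      refine mul_mem (hle hsi) ?_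
      rw [poleProd, ← Finset.prod_inv_distrib]
      exact prod_mem fun j hj => h.inv_one_add_mem (Finset.mem_range.1 hj).le
    · obtain ⟨c, hc, rfl⟩ := h.exists_sum_of_mem_succ hf
      choose M hM using fun j => hsf (c j) (hc j)
      refine ⟨(Finset.range ℓ).sup M + 1, ?_⟩
      rw [Finset.mul_sum]
      refine sum_mem fun j hj => ?_
      obtain ⟨d, hd⟩ := Nat.exists_eq_add_of_le (Finset.le_sup (f := M) hj)
      rw [hd, show (s * poleProd ℓ x (i + 1)) ^ (M j + d + 1) * (c j * x (i + 1) ^ j) =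
        (s ^ M j * c j) * (s ^ (d + 1) * poleProd ℓ x (i + 1) ^ (M j + d)) *
          (poleProd ℓ x (i + 1) * x (i + 1) ^ j) by ring]
      exact mul_mem (mul_mem (hR (hM j)) (mul_mem (pow_mem hsR _) (pow_mem hpR _)))
        (hreg j (Finset.mem_range.1 hj).le)

lemma point_ext (h : GSTower k ℓ x) {i : ℕ} {φ ψ : towerRing k ℓ x i →ₐ[k] k}
    (hφψ : ∀ f (hf : f ∈ regRing k ℓ x i), φ ⟨f, hf.1⟩ = ψ ⟨f, hf.1⟩) : φ = ψ := by
  obtain ⟨s, hs, hs0, hsi, hsf⟩ := h.exists_denominator i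
  ext ⟨f, hf⟩
  obtain ⟨M, hM⟩ := hsf f hf
  have hu : φ ⟨s, hs.1⟩ * φ ⟨s⁻¹, hsi⟩ = 1 := by
    rw [← map_mul, ← map_one φ]
    exact congrArg φ (Subtype.ext (mul_inv_cancel₀ hs0))
  refine mul_left_cancel₀ (pow_ne_zero M (left_ne_zero_of_mul_eq_one hu)) ?_
  have h1 := hφψ _ hM
  have h2 : (⟨s ^ M * f, hM.1⟩ : towerRing k ℓ x i) = ⟨s, hs.1⟩ ^ M * ⟨f, hf⟩ := rfl
  rw [h2, map_mul, map_mul, map_pow, map_pow, ← hφψ s hs] at h1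
  exact h1

lemma exists_separating (h : GSTower k ℓ x) {i : ℕ} {ι : Type*} [DecidableEq ι]
    {p : ι → (towerRing k ℓ x i →ₐ[k] k)} (hp : Function.Injective p) (Z : Finset ι) (t : ι) :
    ∃ f, ∃ hf : f ∈ regRing k ℓ x i,
      ∀ u ∈ insert t Z, p u ⟨f, hf.1⟩ = if u = t then 1 else 0 := by
  have hsep : ∀ u, u ≠ t → ∃ f, ∃ hf : f ∈ regRing k ℓ x i,
      p t ⟨f, hf.1⟩ = 1 ∧ p u ⟨f, hf.1⟩ = 0 := fun u hu => by
    have hne : ¬ ∀ f (hf : f ∈ regRing k ℓ x i), p t ⟨f, hf.1⟩ = p u ⟨f, hf.1⟩ :=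
      fun hall => hu (hp (h.point_ext hall)).symm
    push Not at hne
    obtain ⟨f, hf, hfne⟩ := hne
    set c := p t ⟨f, hf.1⟩ with hc
    set d := p u ⟨f, hf.1⟩ with hd
    have hcd : c - d ≠ 0 := sub_ne_zero.2 hfne
    have hg : (c - d)⁻¹ • (f - algebraMap k L d) ∈ regRing k ℓ x i :=
      Subalgebra.smul_mem _ (sub_mem hf (Subalgebra.algebraMap_mem _ d)) _
    have hval : ∀ φ : towerRing k ℓ x i →ₐ[k] k, φ ⟨_, hg.1⟩ =
        (c - d)⁻¹ * (φ ⟨f, hf.1⟩ - d) := fun φ => by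
      have : (⟨_, hg.1⟩ : towerRing k ℓ x i) =
        (c - d)⁻¹ • (⟨f, hf.1⟩ - algebraMap k _ d) := rfl
      rw [this, map_smul, map_sub, AlgHom.commutes]
      rfl
    exact ⟨_, hg, by rw [hval, ← hc, inv_mul_cancel₀ hcd], by rw [hval, ← hd, sub_self, mul_zero]⟩
  induction Z using Finset.induction_on with
  | empty =>
    refine ⟨1, one_mem _, fun u hu => ?_⟩
    rw [if_pos (by simpa using hu)]
    exact map_one (p u)
  | insert w Z _ ih =>
    obtain ⟨f, hf, hfv⟩ := ih
    by_cases hw : w = t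
    · refine ⟨f, hf, fun u hu => hfv u ?_⟩
      rw [hw, Finset.insert_idem] at hu
      exact hu
    obtain ⟨g, hg, hg1, hg0⟩ := hsep w hw
    have hval : ∀ φ : towerRing k ℓ x i →ₐ[k] k, φ ⟨f * g, (mul_mem hf hg).1⟩ =
        φ ⟨f, hf.1⟩ * φ ⟨g, hg.1⟩ := fun φ => map_mul φ ⟨f, hf.1⟩ ⟨g, hg.1⟩
    refine ⟨f * g, mul_mem hf hg, fun u hu => ?_⟩
    rw [hval]
    by_cases hut : u = t
    · rw [hut, hg1, mul_one]
      exact hfv t (Finset.mem_insert_self _ _)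
    rw [if_neg hut]
    by_cases huw : u = w
    · rw [huw, hg0, mul_zero]
    · rw [hfv u (by simp only [Finset.mem_insert] at hu ⊢; tauto), if_neg hut, zero_mul]

lemma mul_mem_polarFil {y z f g : L} {m n : ℕ} (hf : f ∈ polarFil k y z m)
    (hg : g ∈ polarFil k y z n) : f * g ∈ polarFil k y z (m + n) := by
  intro A hA hy
  rcases hf A hA hy with rfl | h1
  · exact Or.inl (zero_mul _)
  rcases hg A hA hy with rfl | h2
  · exact Or.inl (mul_zero _)
  right
  rw [map_mul, pow_add]
  exact mul_lt_mul'' h1 h2 zero_le zero_le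

lemma card_zeros_le (h : GSTower k ℓ x) {i D : ℕ} {ι : Type*}
    {p : ι → (towerRing k ℓ x i →ₐ[k] k)} (hp : Function.Injective p) {f : L}
    (hf : f ∈ regRing k ℓ x i) (hfD : f ∈ polarFil k (x 0) (x i) D) (hf0 : f ≠ 0)
    (Z : Finset ι) (hZ : ∀ t ∈ Z, p t ⟨f, hf.1⟩ = 0) : Z.card ≤ D := by
  classical
  choose e he hev using h.exists_separating hp Z
  choose m hm using fun t => h.exists_mem_polarFil (he t).1 0
  let M := Z.sup m
  let X : ℕ → Submodule k L := fun n =>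
    Subalgebra.toSubmodule (regRing k ℓ x i) ⊓ polarFil k (x 0) (x i) n
  have hX : IsSlowFiltration X := h.isSlowFiltration i le_rfl
  have hmono := monotone_nat_of_le_succ (h.polarFil_le_succ i)
  have := hX.finiteDimensional (M + D)
  let j : X (M + D) →ₗ[k] towerRing k ℓ x i :=
    Submodule.inclusion (p := X (M + D)) (p' := Subalgebra.toSubmodule (towerRing k ℓ x i))
      fun g hg => hg.1.1
  let ev : X (M + D) →ₗ[k] (Z → k) := LinearMap.pi fun t => (p t).toLinearMap ∘ₗ j
  have hsurj : Function.Surjective ev := by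
    rw [← LinearMap.range_eq_top, eq_top_iff, ← (Pi.basisFun k Z).span_eq, Submodule.span_le]
    rintro _ ⟨t, rfl⟩
    refine ⟨⟨e t, he t, hmono ?_ (hm t)⟩, ?_⟩
    · have := Finset.le_sup (f := m) t.2
      change m t ≤ M at this
      omega
    · ext u
      rw [Pi.basisFun_apply, Pi.single_apply]
      exact (hev t u (Finset.mem_insert_of_mem u.2)).trans (by simp only [Subtype.ext_iff])
  have hker : ∀ g : X M, f * g ∈ X (M + D) := fun g =>
    ⟨(regRing k ℓ x i).mul_mem hf g.2.1, add_comm D M ▸ mul_mem_polarFil hfD g.2.2⟩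
  let μ : X M →ₗ[k] LinearMap.ker ev :=
    { toFun := fun g => ⟨⟨f * g, hker g⟩, by
        rw [LinearMap.mem_ker]
        ext t
        have : p t (⟨f, hf.1⟩ * ⟨g, g.2.1.1⟩) = 0 := by rw [map_mul, hZ t t.2, zero_mul]
        exact this⟩
      map_add' := fun a b => Subtype.ext (Subtype.ext (mul_add f a b))
      map_smul' := fun c a => Subtype.ext (Subtype.ext (mul_smul_comm c f (a : L))) }
  have hμ : Function.Injective μ := fun a b hab => by
    have : f * a = f * b := congrArg (fun w : LinearMap.ker ev => ((w : X (M + D)) : L)) hab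
    exact Subtype.ext (mul_left_cancel₀ hf0 this)
  have h1 := LinearMap.finrank_le_finrank_of_injective hμ
  have h2 := LinearMap.finrank_range_add_finrank_ker ev
  have h3 := hX.finrank_add_le M D
  rw [LinearMap.range_eq_top.2 hsurj, finrank_top, Module.finrank_fintype_fun_eq_card,
    Fintype.card_coe] at h2
  omega

end GSTower

section

lemma isFrameproof_of_card_agree_le {S : Type*} [Finite S] [DecidableEq S] {n s D : ℕ}
    {C : Set (Fin n → S)} (hD : s * D < n)
    (hC : ∀ a ∈ C, ∀ b ∈ C, a ≠ b → (Finset.univ.filter fun t => a t = b t).card ≤ D) :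
    IsFrameproof s C := by
  intro A hAC hA
  refine Set.Subset.antisymm ?_ fun a ha => ⟨fun t => ⟨a, ha, rfl⟩, hAC ha⟩
  rintro a ⟨ha, haC⟩
  by_contra haA
  have hfin : A.Finite := A.toFinite
  have hcover : (Finset.univ : Finset (Fin n)) ⊆
      hfin.toFinset.biUnion fun b => Finset.univ.filter fun t => a t = b t := fun t _ => by
    obtain ⟨b, hb, hab⟩ := ha t
    simp only [Finset.mem_biUnion, Finset.mem_filter]
    exact ⟨b, hfin.mem_toFinset.2 hb, Finset.mem_univ t, hab⟩
  have h1 := (Finset.card_le_card hcover).trans (Finset.card_biUnion_le_card_mul _ _ D fun b hb =>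
    have hbA := hfin.mem_toFinset.1 hb
    hC a haC b (hAC hbA) fun hab => haA (hab ▸ hbA))
  rw [Finset.card_univ, Fintype.card_fin, ← Set.ncard_eq_toFinset_card A hfin] at h1
  have := Nat.mul_le_mul_right D hA
  omega

lemma ncard_le_pow {q n : ℕ} (C : Set (Fin n → Fin q)) : C.ncard ≤ q ^ n :=
  (Set.ncard_le_card C).trans (by simp)

lemma ncard_le_Mfp {q n s : ℕ} {C : Set (Fin n → Fin q)} (hC : IsFrameproof s C) :
    C.ncard ≤ Mfp q n s :=
  le_csSup ⟨q ^ n, by rintro _ ⟨C, -, rfl⟩; exact ncard_le_pow C⟩ ⟨C, hC, rfl⟩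

lemma Mfp_le_pow (q n s : ℕ) : Mfp q n s ≤ q ^ n := by
  rcases Set.eq_empty_or_nonempty {M | ∃ C : Set (Fin n → Fin q), IsFrameproof s C ∧ C.ncard = M}
    with h | h
  · rw [Mfp, h, csSup_empty]; exact Nat.zero_le _
  · exact csSup_le h (by rintro _ ⟨C, -, rfl⟩; exact ncard_le_pow C)

lemma logb_Mfp_div_le_one {q : ℕ} (hq : 1 < q) (n s : ℕ) :
    Real.logb q (Mfp q n s) / (n : ℝ) ≤ 1 := by
  refine div_le_one_of_le₀ ?_ n.cast_nonneg
  have hq' : (1 : ℝ) < q := by exact_mod_cast hq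
  rcases Nat.eq_zero_or_pos (Mfp q n s) with h | h
  · rw [h, Nat.cast_zero, Real.logb_zero]; exact n.cast_nonneg
  · rw [Real.logb_le_iff_le_rpow hq' (by exact_mod_cast h), Real.rpow_natCast]
    exact_mod_cast Mfp_le_pow q n s

lemma le_Rfp_of_frequently {q s : ℕ} (hq : 1 < q) {b : ℝ}
    (h : ∃ᶠ n in atTop, b ≤ Real.logb q (Mfp q n s) / (n : ℝ)) : b ≤ Rfp q s :=
  le_limsup_of_frequently_le h
    (isBoundedUnder_of ⟨1, fun n => logb_Mfp_div_le_one hq n s⟩)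

end

namespace GSTower

variable {k L : Type*} [Field k] [Field L] [Algebra k L] {ℓ : ℕ} {x : ℕ → L}

lemma exists_pow_le_Mfp (h : GSTower k ℓ x) (i : ℕ) {s D : ℕ} (hs : 0 < s)
    (hD : s * D < (ℓ ^ 2 - ℓ) * ℓ ^ i) :
    ∃ d, D + 1 ≤ d + ℓ ^ (i + 1) ∧ (ℓ ^ 2) ^ d ≤ Mfp (ℓ ^ 2) ((ℓ ^ 2 - ℓ) * ℓ ^ i) s := by
  classical
  have := h.finite
  have hℓ := h.two_le
  set N := (ℓ ^ 2 - ℓ) * ℓ ^ i with hN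
  obtain ⟨p, hp⟩ : ∃ p : Fin N → (towerRing k ℓ x i →ₐ[k] k), Function.Injective p :=
    h.exists_points i
  let V : Submodule k L := Subalgebra.toSubmodule (regRing k ℓ x i) ⊓ polarFil k (x 0) (x i) D
  have : FiniteDimensional k V := (h.isSlowFiltration i le_rfl).finiteDimensional D
  have : Finite V := Module.finite_of_finite k
  let e : k ≃ Fin (ℓ ^ 2) := (Finite.equivFinOfCardEq h.card)
  let c : V → Fin N → Fin (ℓ ^ 2) := fun f t => e (p t ⟨f, f.2.1.1⟩)
  have hagree : ∀ f g : V, f ≠ g → (Finset.univ.filter fun t => c f t = c g t).card ≤ D := by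
    intro f g hfg
    refine h.card_zeros_le hp (f - g).2.1 (f - g).2.2 ?_ _ fun t ht => ?_
    · rw [Submodule.coe_sub, sub_ne_zero]
      exact fun hc => hfg (Subtype.ext hc)
    · have h1 := e.injective (Finset.mem_filter.1 ht).2
      have h2 : p t (⟨f, f.2.1.1⟩ - ⟨g, g.2.1.1⟩) = 0 := by rw [map_sub, h1, sub_self]
      exact h2
  have hinj : Function.Injective c := fun f g hfg => by
    by_contra hne
    have h1 := hagree f g hne
    rw [hfg, Finset.filter_true_of_mem fun _ _ => rfl, Finset.card_univ, Fintype.card_fin] at h1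
    have := Nat.le_mul_of_pos_left D hs
    omega
  have hfp : IsFrameproof s (Set.range c) := isFrameproof_of_card_agree_le hD <| by
    rintro _ ⟨f, rfl⟩ _ ⟨g, rfl⟩ hfg
    exact hagree f g fun hc => hfg (congrArg c hc)
  refine ⟨Module.finrank k V, ?_, ?_⟩
  · have h1 := h.gap i D
    have ha := Nat.one_le_pow ((i + 2) / 2) ℓ (by omega)
    have hb := Nat.one_le_pow ((i + 1) / 2) ℓ (by omega)
    have hab : ℓ ^ (i + 1) = ℓ ^ ((i + 2) / 2) * ℓ ^ ((i + 1) / 2) := by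
      rw [← pow_add]; congr 1; omega
    obtain ⟨a, ha'⟩ := Nat.exists_eq_add_of_le' ha
    obtain ⟨b, hb'⟩ := Nat.exists_eq_add_of_le' hb
    rw [hab]
    rw [ha', hb', Nat.add_sub_cancel, Nat.add_sub_cancel] at h1
    rw [ha', hb']
    change D + 1 ≤ Module.finrank k ↥(Subalgebra.toSubmodule (regRing k ℓ x i) ⊓
      polarFil k (x 0) (x i) D) + _
    nlinarith
  · refine le_trans (le_of_eq ?_) (ncard_le_Mfp hfp)
    rw [← Set.image_univ, Set.ncard_image_of_injective _ hinj, Set.ncard_univ,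
      Module.natCard_eq_pow_finrank (K := k), h.card]

lemma le_Rfp (h : GSTower k ℓ x) {s : ℕ} (hs : 0 < s) :
    1 / (s : ℝ) - 1 / ((ℓ : ℝ) - 1) ≤ Rfp (ℓ ^ 2) s := by
  have hℓ := h.two_le
  have hq : 1 < ℓ ^ 2 := Nat.one_lt_pow two_ne_zero (by omega)
  refine le_Rfp_of_frequently hq (frequently_atTop.2 fun i => ?_)
  set N := (ℓ ^ 2 - ℓ) * ℓ ^ i with hN
  have hNℓ : N = (ℓ - 1) * ℓ ^ (i + 1) := by
    rw [hN, pow_succ' ℓ i, sq, ← Nat.sub_one_mul, mul_assoc]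
  have hiN : i < ℓ ^ (i + 1) := (Nat.lt_pow_self (by omega)).trans (Nat.pow_lt_pow_succ (by omega))
  have hℓN : ℓ ^ (i + 1) ≤ N := hNℓ ▸ Nat.le_mul_of_pos_left _ (by omega)
  have hN0 : 0 < N := by omega
  refine ⟨N, by omega, ?_⟩
  have hdiv := Nat.div_add_mod (N - 1) s
  have hmod := Nat.mod_lt (N - 1) hs
  obtain ⟨d, hd, hM⟩ := h.exists_pow_le_Mfp i (s := s) (D := (N - 1) / s) hs (by omega)
  have hlog : (d : ℝ) ≤ Real.logb ((ℓ ^ 2 : ℕ) : ℝ) (Mfp (ℓ ^ 2) N s) := by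
    rw [Real.le_logb_iff_rpow_le (by exact_mod_cast hq)
      (by exact_mod_cast (Nat.pow_pos (by omega)).trans_le hM), Real.rpow_natCast]
    exact_mod_cast hM
  have hNR : (0 : ℝ) < N := by exact_mod_cast hN0
  have hsR : (0 : ℝ) < s := by exact_mod_cast hs
  have hℓR : (0 : ℝ) < (ℓ : ℝ) - 1 := by
    rw [sub_pos]; exact_mod_cast hℓ
  have hNle : (N : ℝ) ≤ s * (d + (ℓ : ℝ) ^ (i + 1)) := by
    have : N ≤ s * (d + ℓ ^ (i + 1)) := by
      have := Nat.mul_le_mul_left s hd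
      rw [mul_add, mul_one] at this
      omega
    exact_mod_cast this
  have hNR' : (N : ℝ) = ((ℓ : ℝ) - 1) * (ℓ : ℝ) ^ (i + 1) := by
    rw [hNℓ, Nat.cast_mul, Nat.cast_sub (by omega)]
    push_cast
    ring
  rw [le_div_iff₀ hNR]
  refine le_trans ?_ hlog
  have h1 : 1 / (s : ℝ) * N ≤ d + (ℓ : ℝ) ^ (i + 1) := by
    rw [one_div, inv_mul_le_iff₀ hsR]; exact hNle
  have h2 : 1 / ((ℓ : ℝ) - 1) * N = (ℓ : ℝ) ^ (i + 1) := by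
    rw [hNR', one_div, inv_mul_cancel_left₀ hℓR.ne']
  rw [sub_mul, h2]
  linarith

end GSTower

lemma transcendental_of_step {k L : Type*} [Field k] [Field L] [Algebra k L] {ℓ : ℕ} (hℓ : 2 ≤ ℓ)
    {a y : L} (ha : Transcendental k a) (hy : addPoly ℓ y * (1 + a ^ (ℓ - 1)) = a ^ ℓ) :
    Transcendental k y := by
  intro halg
  refine ha ?_
  have : Algebra.IsAlgebraic k (algebraicClosure k L) := inferInstance
  let T : algebraicClosure k L := addPoly ℓ ⟨y, mem_algebraicClosure_iff.2 halg⟩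
  let Q : (algebraicClosure k L)[X] := X ^ ℓ - C T * (1 + X ^ (ℓ - 1))
  have hQ : Q ≠ 0 := by
    intro h0
    have := congrArg (fun P => P.coeff ℓ) h0
    simp [Q, coeff_X_pow, coeff_one, show ℓ ≠ 0 by omega, show ℓ ≠ ℓ - 1 by omega] at this
  have hQa : aeval a Q = 0 := by
    have hT : algebraMap (algebraicClosure k L) L T = addPoly ℓ y := rfl
    simp only [Q, map_sub, map_mul, map_add, map_pow, map_one, aeval_X, aeval_C]
    rw [hT, hy, sub_self]
  exact IsAlgebraic.restrictScalars k (S := algebraicClosure k L) ⟨Q, hQ, hQa⟩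

lemma exists_step {k L : Type*} [Field k] [Field L] [Algebra k L] [IsAlgClosed L] {ℓ : ℕ}
    (hℓ : 2 ≤ ℓ) {a : L} (ha : Transcendental k a) :
    ∃ y, addPoly ℓ y * (1 + a ^ (ℓ - 1)) = a ^ ℓ := by
  have h1 : 1 + a ^ (ℓ - 1) ≠ 0 := fun h0 => ha
    ⟨1 + X ^ (ℓ - 1), fun hP => by
      have := congrArg (fun P => P.coeff (ℓ - 1)) hP
      simp [coeff_one, show ℓ - 1 ≠ 0 by omega] at this, by simpa using h0⟩
  let P : L[X] := X ^ ℓ + (X - C (a ^ ℓ / (1 + a ^ (ℓ - 1))))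
  have hP : P.degree = ℓ := by
    rw [degree_add_eq_left_of_degree_lt, degree_X_pow]
    rw [degree_X_sub_C, degree_X_pow]
    exact_mod_cast hℓ
  obtain ⟨y, hy⟩ := IsAlgClosed.exists_root P (by rw [hP]; exact_mod_cast (by omega : ℓ ≠ 0))
  refine ⟨y, ?_⟩
  simp only [P, IsRoot.def, eval_add, eval_sub, eval_pow, eval_X, eval_C] at hy
  rw [addPoly, ← eq_div_iff h1]
  linear_combination hy

lemma exists_gsTower (p e : ℕ) [Fact p.Prime] (he : e ≠ 0) :
    ∃ x : ℕ → AlgebraicClosure (RatFunc (GaloisField p (2 * e))),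
      GSTower (GaloisField p (2 * e)) (p ^ e) x := by
  set k := GaloisField p (2 * e)
  let L := AlgebraicClosure (RatFunc k)
  have hp := Fact.out (p := p.Prime)
  have hℓ : 2 ≤ p ^ e := hp.two_le.trans (Nat.le_self_pow he p)
  have htr : Transcendental k (algebraMap (RatFunc k) L RatFunc.X) :=
    (transcendental_algebraMap_iff (algebraMap (RatFunc k) L).injective).2 RatFunc.transcendental_X
  let next : {a : L // Transcendental k a} → {a : L // Transcendental k a} := fun a =>
    ⟨(exists_step hℓ a.2).choose, transcendental_of_step hℓ a.2 (exists_step hℓ a.2).choose_spec⟩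
  let x : ℕ → {a : L // Transcendental k a} := fun n => next^[n] ⟨_, htr⟩
  have : CharP L p := charP_of_injective_algebraMap (algebraMap k L).injective p
  refine ⟨fun n => x n, hℓ, fun a b => add_pow_char_pow a b p e, ?_, htr, fun i => ?_⟩
  · rw [GaloisField.card p (2 * e) (by omega), ← pow_mul, mul_comm]
  · change addPoly _ ((next^[i + 1] ⟨_, htr⟩ : {a : L // Transcendental k a}) : L) * _ = _
    rw [Function.iterate_succ_apply']
    exact (exists_step hℓ (x i).2).choose_spec

/-- For a square prime power `q = r^2` and an integer `2 ≤ s ≤ √q − 1 = r − 1`,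
`R_q(s) ≥ 1/s − 1/(√q − 1)`. -/
theorem stmt14 (q r s : ℕ) (hq : IsPrimePow q) (hr : q = r ^ 2)
    (hs : 2 ≤ s) (hsr : s ≤ r - 1) :
    1 / (s : ℝ) - 1 / ((r : ℝ) - 1) ≤ Rfp q s := by
  obtain ⟨p, e, hp, he, rfl⟩ := (isPrimePow_nat_iff r).1
    ((isPrimePow_pow_iff two_ne_zero).1 (hr ▸ hq))
  have := Fact.mk hp
  obtain ⟨x, hx⟩ := exists_gsTower p e he.ne'
  exact hr ▸ hx.le_Rfp (by omega)
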